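/- arXiv:0708.2776 — 4 statements merged into one kernel-verified Lean document; each statement's English description precedes it below -/
import Mathlib

section
/- Every 3-regular bipartite graph is antimagic. -/
open Finset

/-- The vertex-sum of `v` under edge labeling `f`: the sum of labels on edges incident to `v`. -/
def vertexSum {V : Type*} [Fintype V] [DecidableEq V] (G : SimpleGraph V)
    [DecidableRel G.Adj] (f : Sym2 V → ℕ) (v : V) : ℕ :=
  ∑ e ∈ G.incidenceFinset v, f e

/-- A graph is antimagic if some bijective labeling of its edges by `{1, …, |E(G)|}`
has pairwise distinct vertex-sums. -/
def IsAntimagic {V : Type*} [Fintype V] [DecidableEq V] (G : SimpleGraph V)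
    [DecidableRel G.Adj] : Prop :=
  ∃ f : Sym2 V → ℕ,
    Set.BijOn f ↑G.edgeFinset ↑(Finset.Icc 1 G.edgeFinset.card) ∧
    ∀ u v : V, u ≠ v → vertexSum G f u ≠ vertexSum G f v

/-- Position of each point along its cycle, counted from a chosen representative. -/
theorem exists_cycle_index {A : Type*} [Finite A] (σ : Equiv.Perm A) :
    ∃ k : A → ℕ, (∀ x, k (σ x) = k x + 1 ∨ k (σ x) = 0) ∧
      ∀ x, k x = 0 → k (σ x) = 0 → σ x = x := by
  classical
  let r : A → A := fun x => (Quotient.mk (Equiv.Perm.SameCycle.setoid σ) x).out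
  have hr : ∀ x, r (σ x) = r x := fun x => by
    have : Quotient.mk (Equiv.Perm.SameCycle.setoid σ) (σ x) =
        Quotient.mk (Equiv.Perm.SameCycle.setoid σ) x :=
      Quotient.sound (Equiv.Perm.sameCycle_apply_left.2 (Equiv.Perm.SameCycle.refl σ x))
    simp only [r, this]
  have hex : ∀ x, ∃ j : ℕ, (σ ^ j) (r x) = x := fun x => by
    have h : σ.SameCycle (r x) x :=
      Quotient.exact (Quotient.out_eq (Quotient.mk (Equiv.Perm.SameCycle.setoid σ) x))
    obtain ⟨j, -, hj⟩ := h.exists_pow_eq'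
    exact ⟨j, hj⟩
  have hk0 : ∀ x, Nat.find (hex x) = 0 → r x = x := fun x h => by
    have := Nat.find_spec (hex x)
    rwa [h] at this
  refine ⟨fun x => Nat.find (hex x), fun x => ?_, fun x h h' => ?_⟩
  · dsimp only
    rcases hm : Nat.find (hex (σ x)) with _ | m
    · exact Or.inr rfl
    · left
      have h1 := Nat.find_spec (hex (σ x))
      rw [hm, hr, pow_succ', Equiv.Perm.mul_apply] at h1
      have h2 : Nat.find (hex x) ≤ m := Nat.find_min' _ (σ.injective h1)
      have h3 : Nat.find (hex (σ x)) ≤ Nat.find (hex x) + 1 := by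
        apply Nat.find_min'
        rw [hr, pow_succ', Equiv.Perm.mul_apply, Nat.find_spec (hex x)]
      omega
  · rw [← hk0 _ h', hr, hk0 _ h]

/-- A finite type can be enumerated compatibly with a given key. -/
theorem exists_equiv_fin_of_key {A : Type*} [Fintype A] (κ : A → ℕ) :
    ∃ q : A ≃ Fin (Fintype.card A), ∀ a b, κ a < κ b → q a < q b := by
  let e := Fintype.equivFin A
  refine ⟨e.trans (Tuple.sort (κ ∘ e.symm)).symm, fun a b h => ?_⟩
  by_contra! hle
  have := Tuple.monotone_sort (κ ∘ e.symm) hle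
  simp at this
  omega

theorem rank_lt_card {A : Type*} [Fintype A] {n : ℕ} (q : A ≃ Fin n) (S : Finset A)
    (h : ∀ a ∈ S, ∀ b ∉ S, q a < q b) {a : A} (ha : a ∈ S) : (q a : ℕ) < S.card := by
  have h1 : (Finset.Iic (q a)).map q.symm.toEmbedding ⊆ S := by
    intro b hb
    by_contra hbS
    have := h a ha b hbS
    simp only [Finset.mem_map_equiv, Equiv.symm_symm, Finset.mem_Iic] at hb
    exact absurd this (not_lt.2 hb)
  have := Finset.card_le_card h1
  simp at this
  omega

theorem le_rank_add_card {A : Type*} [Fintype A] {n : ℕ} (q : A ≃ Fin n) (S : Finset A)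
    (h : ∀ a ∈ S, ∀ b ∉ S, q b < q a) {a : A} (ha : a ∈ S) : n ≤ q a + S.card := by
  have h1 : (Finset.Ici (q a)).map q.symm.toEmbedding ⊆ S := by
    intro b hb
    by_contra hbS
    have := h a ha b hbS
    simp only [Finset.mem_map_equiv, Equiv.symm_symm, Finset.mem_Ici] at hb
    exact absurd this (not_lt.2 hb)
  have := Finset.card_le_card h1
  simp at this
  omega

/-- An almost alternating 2-colouring along the cycles of a fixed-point-free permutation: the
colouring fails to alternate only on a small set `T`. -/
theorem exists_almost_alternating {A : Type*} [Fintype A] [DecidableEq A] (σ : Equiv.Perm A)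
    (hσ : ∀ x, σ x ≠ x) :
    ∃ (o : A → Bool) (T : Finset A), (∀ x ∉ T, o (σ x) = !o x) ∧
      (∀ x ∈ T, o x = true ∧ o (σ x) = true ∧ σ x ∉ T) ∧ 3 * T.card ≤ Fintype.card A := by
  obtain ⟨k, hk, hk0⟩ := exists_cycle_index σ
  let T : Finset A := {x | k (σ x) = 0 ∧ k x % 2 = 0}
  have hT : ∀ x, x ∈ T ↔ k (σ x) = 0 ∧ k x % 2 = 0 := fun x => by simp [T]
  have h2 : ∀ x ∈ T, 2 ≤ k x := fun x hx => by
    have := (hT x).1 hx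
    have := mt (hk0 x) fun h => hσ x (h this.1)
    omega
  have h1 : ∀ x ∈ T, k (σ (σ x)) = 1 := fun x hx => by
    have h0 := ((hT x).1 hx).1
    have := mt (hk0 (σ x) h0) (hσ _)
    have := hk (σ x)
    omega
  refine ⟨fun x => decide (k x % 2 = 0), T, fun x hx => ?_, fun x hx => ?_, ?_⟩
  · rw [hT] at hx
    rcases hk x with h | h <;> rw [← decide_not, decide_eq_decide] <;> omega
  · have h := (hT x).1 hx
    refine ⟨by simp [h.2], by simp [h.1], fun h' => ?_⟩
    have := h2 _ h'
    omega
  · have hinj : Set.InjOn (fun p : A × Fin 3 => (σ ^ (p.2 : ℕ)) p.1)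
        ((T ×ˢ univ : Finset (A × Fin 3)) : Set (A × Fin 3)) := by
      rintro ⟨x, i⟩ hx ⟨y, j⟩ hy hxy
      simp only [coe_product, coe_univ, Set.mem_prod, mem_coe, Set.mem_univ, and_true] at hx hy
      have hx0 := ((hT x).1 hx).1
      have hy0 := ((hT y).1 hy).1
      have hx1 := h1 x hx
      have hy1 := h1 y hy
      have hx2 := h2 x hx
      have hy2 := h2 y hy
      have hxy' := congrArg k hxy
      fin_cases i <;> fin_cases j <;> simp [pow_two] at hxy hxy' ⊢ <;> first | exact hxy | omega
    have := Finset.card_le_card_of_injOn _ (fun _ _ => mem_univ _) hinj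
    simp at this
    omega

/-- The labels of two of the three matchings, together with a ranking that determines the labels
of the third one. The pair sums `l x + l' x` are constant, and adding multiples of three according
to the ranking makes the sums `l (σ x) + l' x` distinct, and distinct from `3 * n + 3 * j`. -/
theorem exists_pair_labels {A : Type*} [Fintype A] (σ : Equiv.Perm A) (hσ : ∀ x, σ x ≠ x) :
    ∃ (q : A ≃ Fin (Fintype.card A)) (l l' : A → ℕ),
      (∀ a, l a + l' a = 3 * Fintype.card A) ∧
      (∀ a, l a % 3 ≠ 0) ∧ (∀ a, l' a % 3 ≠ 0) ∧
      l.Injective ∧ l'.Injective ∧ (∀ a b, l a ≠ l' b) ∧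
      (Function.Injective fun x => l (σ x) + l' x + 3 * ((q x : ℕ) + 1)) ∧
      ∀ x y, l (σ x) + l' x + 3 * ((q x : ℕ) + 1) ≠ 3 * Fintype.card A + 3 * ((q y : ℕ) + 1) := by
  classical
  obtain ⟨o, T, ho, hT, hcard⟩ := exists_almost_alternating σ hσ
  set n := Fintype.card A with hn
  obtain ⟨p, hp⟩ := exists_equiv_fin_of_key
    (fun x => if x ∈ T then 2 else if σ.symm x ∈ T then 0 else 1)
  have hpT : ∀ x ∈ T, n ≤ p x + T.card := fun x hx => by
    refine le_rank_add_card p T (fun a ha b hb => hp _ _ ?_) hx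
    simp only [ha, hb, if_true, if_false]
    split_ifs <;> omega
  have hpσT : ∀ x ∈ T, (p (σ x) : ℕ) < T.card := fun x hx => by
    have := rank_lt_card p (T.map σ.toEmbedding) (a := σ x) (fun a ha b hb => hp _ _ ?_)
      (by simpa using hx)
    · simpa using this
    · obtain ⟨y, hy, rfl⟩ := Finset.mem_map.1 ha
      have hb' : σ.symm b ∉ T := fun h => hb (Finset.mem_map.2 ⟨_, h, by simp⟩)
      have := (hT y hy).2.2
      simp only [Equiv.coe_toEmbedding, this, hb', Equiv.symm_apply_apply, hy, if_true, if_false]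
      split_ifs <;> omega
  let l : A → ℕ := fun a => if o a then 3 * p a + 1 else 3 * (n - 1 - p a) + 2
  let l' : A → ℕ := fun a => if o a then 3 * (n - 1 - p a) + 2 else 3 * p a + 1
  have hinj : ∀ a b, (p a : ℕ) = p b → a = b := fun a b h => p.injective (Fin.ext h)
  have hs : ∀ x ∉ T, (l (σ x) + l' x) % 3 ≠ 0 := fun x hx => by
    simp only [l, l', ho x hx]
    cases o x <;> simp <;> omega
  have hsT : ∀ x ∈ T, (l (σ x) + l' x) % 3 = 0 ∧ l (σ x) + l' x + 3 ≤ 6 * T.card := fun x hx => by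
    have := hT x hx
    have := hpT x hx
    have := hpσT x hx
    simp only [l, l', hT x hx, if_true]
    omega
  have hle : ∀ x, l (σ x) + l' x < 6 * n := fun x => by
    have := (p x).2
    have := (p (σ x)).2
    simp only [l, l']
    split_ifs <;> omega
  obtain ⟨q, hq⟩ := exists_equiv_fin_of_key
    (fun x => l (σ x) + l' x + if x ∈ T then 0 else 6 * n)
  have hqT : ∀ x ∈ T, (q x : ℕ) < T.card := fun x hx => by
    refine rank_lt_card q T (fun a ha b hb => hq _ _ ?_) hx
    have := hle a
    simp only [ha, hb, if_true, if_false]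
    omega
  have hmono : ∀ x y, q x < q y →
      l (σ x) + l' x + 3 * ((q x : ℕ) + 1) ≠ l (σ y) + l' y + 3 * ((q y : ℕ) + 1) := by
    intro x y hxy
    have h := mt (hq y x) hxy.asymm
    have hxy' : (q x : ℕ) < q y := hxy
    by_cases hx : x ∈ T <;> by_cases hy : y ∈ T
    · simp only [hx, hy, if_true] at h
      omega
    · have := hsT x hx
      have := hs y hy
      omega
    · have := hsT y hy
      have := hs x hx
      omega
    · simp only [hx, hy, if_false] at h
      omega
  refine ⟨q, l, l', fun a => ?_, fun a => ?_, fun a => ?_, fun a b h => ?_, fun a b h => ?_,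
    fun a b h => ?_, fun x y h => ?_, fun x y h => ?_⟩
  · have := (p a).2
    simp only [l, l']
    split_ifs <;> omega
  · simp only [l]
    split_ifs <;> omega
  · simp only [l']
    split_ifs <;> omega
  · apply hinj
    have := (p a).2
    have := (p b).2
    simp only [l] at h
    split_ifs at h <;> omega
  · apply hinj
    have := (p a).2
    have := (p b).2
    simp only [l'] at h
    split_ifs at h <;> omega
  · have := (p a).2
    have := (p b).2
    have hab : o a = !o b ∧ (p a : ℕ) = p b := by
      simp only [l, l'] at h
      cases ha : o a <;> cases hb : o b <;> simp only [ha, hb] at h <;> simp at h ⊢ <;> omega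
    rw [hinj a b hab.2] at hab
    simp at hab
  · rcases lt_trichotomy (q x) (q y) with hlt | heq | hlt
    · exact (hmono x y hlt h).elim
    · exact q.injective heq
    · exact (hmono y x hlt h.symm).elim
  · by_cases hx : x ∈ T
    · have := hsT x hx
      have := hqT x hx
      omega
    · have := hs x hx
      omega

/-- Labels for three disjoint perfect matchings with all vertex sums distinct. -/
theorem exists_matching_labels {A B : Type*} [Fintype A] (m : Fin 3 → A ≃ B)
    (hm : ∀ a, m 1 a ≠ m 2 a) :
    ∃ lab : A × Fin 3 → ℕ, lab.Injective ∧ (∀ x, lab x ∈ Finset.Icc 1 (3 * Fintype.card A)) ∧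
      Function.Injective (Sum.elim (fun a : A => ∑ i, lab (a, i))
        (fun b : B => ∑ i, lab ((m i).symm b, i))) := by
  have hσ : ∀ x, ((m 2).trans (m 1).symm) x ≠ x := fun x h => by
    apply hm x
    rw [Equiv.trans_apply, Equiv.symm_apply_eq] at h
    exact h.symm
  obtain ⟨q, l, l', hsum, hl, hl', hli, hli', hll', hB, hAB⟩ := exists_pair_labels _ hσ
  let t : A → A := fun a => (m 2).symm (m 0 a)
  let lab : A × Fin 3 → ℕ := fun x => ![3 * ((q (t x.1) : ℕ) + 1), l x.1, l' x.1] x.2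
  have ht : ∀ a b, (q (t a) : ℕ) = q (t b) → a = b := fun a b h =>
    (m 0).injective ((m 2).symm.injective (q.injective (Fin.ext h)))
  have hsA : ∀ a, ∑ i, lab (a, i) = 3 * Fintype.card A + 3 * ((q (t a) : ℕ) + 1) := fun a => by
    have := hsum a
    simp only [Fin.sum_univ_three, lab, Matrix.cons_val]
    omega
  have hsB : ∀ b, ∑ i, lab ((m i).symm b, i) =
      l (((m 2).trans (m 1).symm) ((m 2).symm b)) + l' ((m 2).symm b) +
        3 * ((q ((m 2).symm b) : ℕ) + 1) := fun b => by
    simp only [Fin.sum_univ_three, lab, Matrix.cons_val, t, Equiv.apply_symm_apply,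
      Equiv.trans_apply]
    omega
  refine ⟨lab, ?_, ?_, ?_⟩
  · rintro ⟨a, i⟩ ⟨b, j⟩ h
    have h1 := hl a
    have h2 := hl b
    have h3 := hl' a
    have h4 := hl' b
    have h5 := hll' a b
    have h6 := hll' b a
    fin_cases i <;> fin_cases j <;> simp [lab] at h ⊢ <;>
      first
      | exact ht a b (congrArg Fin.val h)
      | exact ht a b (by simp [h])
      | exact hli h
      | exact hli' h
      | omega
  · rintro ⟨a, i⟩
    have h1 := hl a
    have h2 := hl' a
    have h3 := hsum a
    have h4 := (q (t a)).2
    rw [Finset.mem_Icc]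
    fin_cases i <;> simp [lab] <;> omega
  · rintro (a | b) (a' | b') h <;> simp only [Sum.elim_inl, Sum.elim_inr, hsA, hsB] at h
    · rw [ht a a' (by omega)]
    · exact (hAB _ _ h.symm).elim
    · exact (hAB _ _ h).elim
    · rw [(m 2).symm.injective (hB h)]

/-- A regular bipartite relation of positive degree contains a perfect matching. -/
theorem exists_equiv_mem_of_regular {A B : Type*} [Fintype A] [Fintype B] [DecidableEq B]
    (t : A → Finset B) (k : ℕ) (hA : ∀ a, (t a).card = k + 1)
    (hB : ∀ b, #{a | b ∈ t a} = k + 1) : ∃ m : A ≃ B, ∀ a, m a ∈ t a := by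
  have hall : ∀ s : Finset A, s.card ≤ (s.biUnion t).card := fun s => by
    have := Finset.card_mul_le_card_mul (s := s) (t := s.biUnion t) (m := k + 1) (n := k + 1)
      (fun a b => b ∈ t a) (fun a ha => ?_) (fun b _ => ?_)
    · exact Nat.le_of_mul_le_mul_right this k.succ_pos
    · rw [← hA a]
      exact Finset.card_le_card fun b hb =>
        Finset.mem_filter.2 ⟨Finset.mem_biUnion.2 ⟨a, ha, hb⟩, hb⟩
    · rw [← hB b]
      exact Finset.card_le_card fun a ha => by
        simpa using (Finset.mem_filter.1 ha).2
  obtain ⟨f, hf, hft⟩ := (Finset.all_card_le_biUnion_card_iff_exists_injective t).1 hall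
  have hcard : Fintype.card A = Fintype.card B := by
    have := Finset.card_mul_eq_card_mul (s := (univ : Finset A)) (t := (univ : Finset B))
      (m := k + 1) (n := k + 1) (fun a b => b ∈ t a)
      (fun a _ => by rw [← hA a]; congr 1; ext; simp [Finset.bipartiteAbove])
      (fun b _ => by rw [← hB b]; rfl)
    exact Nat.eq_of_mul_eq_mul_right k.succ_pos this
  exact ⟨Equiv.ofBijective f ((Fintype.bijective_iff_injective_and_card f).2 ⟨hf, hcard⟩), hft⟩

/-- A regular bipartite relation decomposes into perfect matchings. -/
theorem exists_matching_decomposition {A B : Type*} [Fintype A] [Fintype B] [DecidableEq B]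
    (k : ℕ) (t : A → Finset B) (hA : ∀ a, (t a).card = k)
    (hB : ∀ b, #{a | b ∈ t a} = k) :
    ∃ m : Fin k → A ≃ B, ∀ a, t a = univ.image fun i => m i a := by
  classical
  induction k generalizing t with
  | zero => exact ⟨Fin.elim0, fun a => by simpa using hA a⟩
  | succ k ih =>
    obtain ⟨m₀, hm₀⟩ := exists_equiv_mem_of_regular t k hA hB
    obtain ⟨m, hm⟩ := ih (fun a => (t a).erase (m₀ a))
      (fun a => by rw [Finset.card_erase_of_mem (hm₀ a), hA]; rfl)
      (fun b => by
        have h : ({a | b ∈ (t a).erase (m₀ a)} : Finset A) =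
            ({a | b ∈ t a} : Finset A).erase (m₀.symm b) := by
          ext a
          simp [Equiv.eq_symm_apply, eq_comm]
        rw [h, Finset.card_erase_of_mem, hB]
        · rfl
        · simpa using hm₀ (m₀.symm b))
    refine ⟨Fin.cons m₀ m, fun a => ?_⟩
    rw [← Finset.insert_erase (hm₀ a), hm a]
    ext b
    simp [Fin.exists_fin_succ, eq_comm]

theorem stmt_10 {V : Type*} [Fintype V] [DecidableEq V] (G : SimpleGraph V)
    [DecidableRel G.Adj] (c : V → Bool) (hbip : ∀ u v, G.Adj u v → c u ≠ c v)
    (hreg : G.IsRegularOfDegree 3) : IsAntimagic G := by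
  let A := {v : V // c v = true}
  let B := {v : V // c v = false}
  obtain ⟨m, hm⟩ := exists_matching_decomposition 3
    (fun a : A => ({b : B | G.Adj a b} : Finset B))
    (fun a => by
      rw [← hreg a, ← SimpleGraph.card_neighborFinset_eq_degree, ← Finset.card_map
        (Function.Embedding.subtype _)]
      congr 1
      ext v
      have := hbip a v
      have := a.2
      simp
      grind)
    (fun b => by
      rw [← hreg b, ← SimpleGraph.card_neighborFinset_eq_degree, ← Finset.card_map
        (Function.Embedding.subtype _)]
      congr 1
      ext v
      have := hbip b v
      have := b.2
      have := G.adj_comm b v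
      simp
      grind)
  have hadj : ∀ (a : A) (b : B), G.Adj a b ↔ ∃ i, m i a = b := fun a b => by
    simpa using congrArg (b ∈ ·) (hm a)
  have hmi : ∀ a, Function.Injective fun i => m i a := fun a => by
    rw [← Set.injOn_univ, ← Finset.coe_univ, ← Finset.card_image_iff, ← hm a]
    have h := hreg a
    rw [← SimpleGraph.card_neighborFinset_eq_degree] at h
    rw [Finset.card_univ, Fintype.card_fin, ← h, ← Finset.card_map
        (Function.Embedding.subtype _)]
    congr 1
    ext v
    have := hbip a v
    have := a.2
    simp
    grind
  obtain ⟨lab, hlab, hlabm, hsum⟩ := exists_matching_labels m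
    fun a h => absurd (hmi a h) (by decide)
  let Φ : A × Fin 3 → Sym2 V := fun x => s(x.1, m x.2 x.1)
  have hΦ : Φ.Injective := by
    rintro ⟨a, i⟩ ⟨a', i'⟩ h
    have h1 := a.2
    have h2 := (m i' a').2
    simp only [Φ, Sym2.eq_iff] at h
    rcases h with ⟨h, h'⟩ | ⟨h, -⟩
    · obtain rfl := Subtype.ext h
      rw [hmi a (Subtype.ext h')]
    · simp [h, h2] at h1
  have hΦA : ∀ (x : A × Fin 3) (a : A), (a : V) ∈ Φ x ↔ x.1 = a := fun x a => by
    have := a.2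
    have := (m x.2 x.1).2
    simp only [Φ, Sym2.mem_iff]
    grind
  have hΦB : ∀ (x : A × Fin 3) (b : B), (b : V) ∈ Φ x ↔ x.1 = (m x.2).symm b := fun x b => by
    have := b.2
    have := x.1.2
    simp only [Φ, Sym2.mem_iff, Equiv.eq_symm_apply]
    grind
  have hedge : ∀ e, e ∈ G.edgeSet ↔ ∃ x, Φ x = e := fun e => by
    constructor
    · induction e with | _ u v
      intro h
      rw [SimpleGraph.mem_edgeSet] at h
      have hc := hbip u v h
      rcases hu : c u with _ | _
      · have hv : c v = true := by grind
        obtain ⟨i, hi⟩ := (hadj ⟨v, hv⟩ ⟨u, hu⟩).1 h.symm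
        exact ⟨(⟨v, hv⟩, i), by simp [Φ, hi, Sym2.eq_swap]⟩
      · have hv : c v = false := by grind
        obtain ⟨i, hi⟩ := (hadj ⟨u, hu⟩ ⟨v, hv⟩).1 h
        exact ⟨(⟨u, hu⟩, i), by simp [Φ, hi]⟩
    · rintro ⟨x, rfl⟩
      exact (hadj _ _).2 ⟨_, rfl⟩
  have hE : G.edgeFinset = univ.image Φ := by
    ext e
    simp [hedge]
  have hcard : G.edgeFinset.card = 3 * Fintype.card A := by
    rw [hE, Finset.card_image_of_injective _ hΦ]
    simp [mul_comm]
  have hf : ∀ x, Function.extend Φ lab 0 (Φ x) = lab x := hΦ.extend_apply lab 0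
  have hsA : ∀ a : A, vertexSum G (Function.extend Φ lab 0) a = ∑ i, lab (a, i) := fun a => by
    have h : G.incidenceFinset a = univ.image fun i => Φ (a, i) := by
      ext e
      simp only [SimpleGraph.mem_incidenceFinset, SimpleGraph.incidenceSet, Set.mem_ofPred_eq,
        hedge, Finset.mem_image, Finset.mem_univ, true_and]
      constructor
      · rintro ⟨⟨x, rfl⟩, h⟩
        exact ⟨x.2, by rw [← (hΦA x a).1 h]⟩
      · rintro ⟨i, rfl⟩
        exact ⟨⟨_, rfl⟩, (hΦA _ _).2 rfl⟩
    rw [vertexSum, h, Finset.sum_image fun i _ j _ hij => (Prod.ext_iff.1 (hΦ hij)).2]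
    simp only [hf]
  have hsB : ∀ b : B, vertexSum G (Function.extend Φ lab 0) b =
      ∑ i, lab ((m i).symm b, i) := fun b => by
    have h : G.incidenceFinset b = univ.image fun i => Φ ((m i).symm b, i) := by
      ext e
      simp only [SimpleGraph.mem_incidenceFinset, SimpleGraph.incidenceSet, Set.mem_ofPred_eq,
        hedge, Finset.mem_image, Finset.mem_univ, true_and]
      constructor
      · rintro ⟨⟨x, rfl⟩, h⟩
        exact ⟨x.2, by rw [← (hΦB x b).1 h]⟩
      · rintro ⟨i, rfl⟩
        exact ⟨⟨_, rfl⟩, (hΦB _ _).2 rfl⟩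
    rw [vertexSum, h, Finset.sum_image fun i _ j _ hij => (Prod.ext_iff.1 (hΦ hij)).2]
    simp only [hf]
  have himage : (univ.image lab) = Finset.Icc 1 (3 * Fintype.card A) := by
    refine Finset.eq_of_subset_of_card_le (fun y hy => ?_) ?_
    · obtain ⟨x, -, rfl⟩ := Finset.mem_image.1 hy
      exact hlabm x
    · rw [Finset.card_image_of_injective _ hlab]
      simp [mul_comm]
  refine ⟨Function.extend Φ lab 0, ?_, fun u v huv h => huv ?_⟩
  · rw [hcard, hE, ← himage]
    refine ⟨?_, ?_, ?_⟩
    · intro e he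
      obtain ⟨x, -, rfl⟩ := Finset.mem_image.1 he
      simp [hf]
    · intro e he e' he' h
      obtain ⟨x, -, rfl⟩ := Finset.mem_image.1 he
      obtain ⟨y, -, rfl⟩ := Finset.mem_image.1 he'
      rw [hf, hf] at h
      rw [hlab h]
    · intro y hy
      obtain ⟨x, -, rfl⟩ := Finset.mem_image.1 hy
      exact ⟨Φ x, by simp, hf x⟩
  · rcases hu : c u with _ | _ <;> rcases hv : c v with _ | _
    · rw [hsB ⟨u, hu⟩, hsB ⟨v, hv⟩] at h
      exact congrArg Subtype.val (Sum.inr_injective (@hsum (Sum.inr ⟨u, hu⟩) (Sum.inr ⟨v, hv⟩) h))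
    · rw [hsB ⟨u, hu⟩, hsA ⟨v, hv⟩] at h
      simpa using @hsum (Sum.inr ⟨u, hu⟩) (Sum.inl ⟨v, hv⟩) h
    · rw [hsA ⟨u, hu⟩, hsB ⟨v, hv⟩] at h
      simpa using @hsum (Sum.inl ⟨u, hu⟩) (Sum.inr ⟨v, hv⟩) h
    · rw [hsA ⟨u, hu⟩, hsA ⟨v, hv⟩] at h
      exact congrArg Subtype.val (Sum.inl_injective (@hsum (Sum.inl ⟨u, hu⟩) (Sum.inl ⟨v, hv⟩) h))
end

section
/- If G is a (2l+2)-regular bipartite graph with parts A and B each of size n (l ≥ 0), then G has a labeling (bijection from E(G) to {1,...,(2l+2)n}) such that every vertex of A has the same vertex-sum t, and every vertex of B has vertex-sum not congruent to t modulo 3. -/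
open Finset

/-- Hall's theorem, iterated: a regular bipartite relation is the disjoint
union of bijections. -/
theorem exists_equiv_decomposition {α β : Type*} [Fintype α] [Fintype β] [DecidableEq α]
    [DecidableEq β] (hc : Fintype.card α = Fintype.card β) (d : ℕ) (R : α → β → Prop)
    [∀ a b, Decidable (R a b)]
    (hα : ∀ a, #{b | R a b} = d) (hβ : ∀ b, #{a | R a b} = d) :
    ∃ π : Fin d → α ≃ β, (∀ a, Function.Injective fun i => π i a) ∧
      ∀ a b, R a b ↔ ∃ i, π i a = b := by
  induction d generalizing R with
  | zero =>
    refine ⟨fun i => i.elim0, fun a i => i.elim0, fun a b => ?_⟩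
    have h := hα a
    rw [card_eq_zero, filter_eq_empty_iff] at h
    simpa using h (mem_univ b)
  | succ d ih =>
    have hall : ∀ s : Finset α, #s ≤ #(s.biUnion fun a => ({b | R a b} : Finset β)) := by
      intro s
      have := card_mul_le_card_mul (s := s) (t := s.biUnion fun a => ({b | R a b} : Finset β)) R
        (m := d + 1) (n := d + 1) (fun a ha => by
          rw [← hα a]
          refine card_le_card fun b hb => ?_
          simp only [mem_bipartiteAbove, mem_biUnion, mem_filter, mem_univ, true_and] at hb ⊢
          exact ⟨⟨a, ha, hb⟩, hb⟩) (fun b _ => by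
          rw [← hβ b]
          refine card_le_card fun a ha => ?_
          simp only [mem_bipartiteBelow, mem_filter, mem_univ, true_and] at ha ⊢
          exact ha.2)
      exact Nat.le_of_mul_le_mul_right this (Nat.succ_pos d)
    obtain ⟨g, hg, hgR⟩ := (all_card_le_biUnion_card_iff_exists_injective _).1 hall
    simp only [mem_filter, mem_univ, true_and] at hgR
    let e : α ≃ β := Equiv.ofBijective g
      ((Fintype.bijective_iff_injective_and_card g).2 ⟨hg, hc⟩)
    have heR : ∀ a, R a (e a) := hgR
    obtain ⟨π, hπ, hπR⟩ := ih (fun a b => R a b ∧ e a ≠ b)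
      (fun a => by
        have h : ({b | R a b ∧ e a ≠ b} : Finset β) = ({b | R a b} : Finset β).erase (e a) := by
          ext b; simp [and_comm, eq_comm]
        rw [h, card_erase_of_mem (by simpa using heR a), hα, Nat.add_sub_cancel])
      (fun b => by
        have h : ({a | R a b ∧ e a ≠ b} : Finset α) =
            ({a | R a b} : Finset α).erase (e.symm b) := by
          ext a; simp [and_comm, Equiv.eq_symm_apply]
        rw [h, card_erase_of_mem (by simpa using heR (e.symm b)), hβ, Nat.add_sub_cancel])
    refine ⟨Fin.cons e π, fun a => ?_, fun a b => ?_⟩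
    · intro i j
      refine Fin.cases ?_ (fun i => ?_) i <;> refine Fin.cases ?_ (fun j => ?_) j
      · simp
      · intro h
        exact absurd h ((hπR a _).2 ⟨j, rfl⟩).2
      · intro h
        exact absurd h.symm ((hπR a _).2 ⟨i, rfl⟩).2
      · intro h
        exact congrArg Fin.succ (hπ a h)
    · rw [Fin.exists_fin_succ]
      simp only [Fin.cons_zero, Fin.cons_succ, ← hπR]
      by_cases h : e a = b
      · subst h
        simp [heR a]
      · simp [h]

/-- Greedy colouring: each point of a fixed-point-free permutation has only two neighbours. -/
theorem exists_coloring_sub_ne {α : Type*} [Fintype α] [DecidableEq α] (σ : Equiv.Perm α)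
    (hσ : ∀ x, σ x ≠ x) (c : α → ZMod 3) : ∃ y : α → ZMod 3, ∀ x, y (σ x) - y x ≠ c x := by
  suffices h : ∀ s : Finset α, ∃ y : α → ZMod 3, ∀ x ∈ s, σ x ∈ s → y (σ x) - y x ≠ c x by
    obtain ⟨y, hy⟩ := h univ
    exact ⟨y, fun x => hy x (mem_univ _) (mem_univ _)⟩
  intro s
  induction s using Finset.induction_on with
  | empty => exact ⟨0, by simp⟩
  | insert v s hv ih =>
    obtain ⟨y, hy⟩ := ih
    have key : ∀ a b : ZMod 3, ∃ k, k ≠ a ∧ k ≠ b := by decide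
    obtain ⟨k, hk₁, hk₂⟩ := key (c (σ.symm v) + y (σ.symm v)) (y (σ v) - c v)
    refine ⟨Function.update y v k, fun x hx hσx => ?_⟩
    by_cases hxv : x = v
    · subst hxv
      rw [Function.update_of_ne (hσ x), Function.update_self]
      rintro h
      exact hk₂ (by rw [← h]; ring)
    · rw [Function.update_of_ne hxv]
      by_cases hxv' : σ x = v
      · subst hxv'
        rw [Function.update_self]
        intro h
        refine hk₁ ?_
        simp [← h]
      · rw [Function.update_of_ne hxv']
        exact hy x (mem_of_mem_insert_of_ne hx hxv) (mem_of_mem_insert_of_ne hσx hxv')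

theorem exists_coloring_sub_ne_card_le {α : Type*} [Fintype α] [DecidableEq α]
    (σ : Equiv.Perm α) (hσ : ∀ x, σ x ≠ x) (c : α → ZMod 3) :
    ∃ y : α → ZMod 3, (∀ x, y (σ x) - y x ≠ c x) ∧ #{x | y x = 0} ≤ Fintype.card α / 3 := by
  obtain ⟨y, hy⟩ := exists_coloring_sub_ne σ hσ c
  obtain ⟨k, -, hk⟩ := exists_card_fiber_lt_of_card_lt_mul (s := (univ : Finset α))
    (t := (univ : Finset (ZMod 3))) (f := y) (n := Fintype.card α / 3 + 1)
    (by rw [card_univ, card_univ, ZMod.card]; omega)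
  refine ⟨fun x => y x - k, fun x => by simpa using hy x, ?_⟩
  simpa [sub_eq_zero, Nat.lt_succ_iff] using hk

theorem exists_ne_zero_neighbors {α M : Type*} [Fintype α] [DecidableEq α] [Zero M]
    [DecidableEq M] (σ : Equiv.Perm α) (y : α → M) (F : Finset α)
    (h : 3 * #{x | y x = 0} + #F < Fintype.card α) :
    ∃ x, x ∉ F ∧ y x ≠ 0 ∧ y (σ x) ≠ 0 ∧ y (σ.symm x) ≠ 0 := by
  by_contra! hcon
  set Z : Finset α := {x | y x = 0} with hZ
  have hsub : (univ : Finset α) ⊆ F ∪ (Z ∪ (Z.map σ.symm.toEmbedding ∪ Z.map σ.toEmbedding)) := by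
    intro x _
    by_contra hx
    simp only [hZ, mem_union, mem_map_equiv, mem_filter, mem_univ, true_and, not_or,
      Equiv.symm_symm] at hx
    exact hx.2.2.2 (hcon x hx.1 hx.2.1 hx.2.2.1)
  have h1 := card_le_card hsub
  have h2 := card_union_le F (Z ∪ (Z.map σ.symm.toEmbedding ∪ Z.map σ.toEmbedding))
  have h3 := card_union_le Z (Z.map σ.symm.toEmbedding ∪ Z.map σ.toEmbedding)
  have h4 := card_union_le (Z.map σ.symm.toEmbedding) (Z.map σ.toEmbedding)
  simp only [card_map, card_univ] at h1 h2 h3 h4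
  omega

theorem card_filter_update_zero {α M : Type*} [Fintype α] [DecidableEq α] [Zero M]
    [DecidableEq M] (y : α → M) {x : α} (hx : y x ≠ 0) :
    #{z | Function.update y x 0 z = 0} = #{z | y z = 0} + 1 := by
  have h : univ.filter (fun z => Function.update y x 0 z = 0) =
      insert x (univ.filter fun z => y z = 0) := by
    ext z
    by_cases hz : z = x <;> simp [hz, Function.update_apply]
  rw [h, card_insert_of_notMem (by simpa using hx)]

/-- If the number of zeros can always be raised by one, every larger number is attained. -/
theorem exists_card_eq_of_step {Y : Type*} (V : Y → Prop) (N : Y → ℕ) (k : ℕ)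
    (h₀ : ∃ y, V y ∧ N y ≤ k)
    (step : ∀ y, V y → N y < k → ∃ y', V y' ∧ N y' = N y + 1) : ∃ y, V y ∧ N y = k := by
  obtain ⟨y, hy, hk⟩ := h₀
  induction hm : k - N y generalizing y with
  | zero => exact ⟨y, hy, by omega⟩
  | succ m ih =>
    obtain ⟨y', hy', hN⟩ := step y hy (by omega)
    exact ih y' hy' (by omega) (by omega)

theorem exists_proper_coloring_card_eq {α : Type*} [Fintype α] [DecidableEq α]
    (σ : Equiv.Perm α) (hσ : ∀ x, σ x ≠ x) (k : ℕ) (hk : Fintype.card α / 3 ≤ k)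
    (hk' : 3 * k ≤ Fintype.card α + 2) :
    ∃ y : α → ZMod 3, (∀ x, y (σ x) - y x ≠ 0) ∧ #{x | y x = 0} = k := by
  refine exists_card_eq_of_step (fun y : α → ZMod 3 => ∀ x, y (σ x) - y x ≠ 0)
    (fun y => #{x | y x = 0}) k ?_ ?_
  · obtain ⟨y, hy, hc⟩ := exists_coloring_sub_ne_card_le σ hσ 0
    exact ⟨y, hy, hc.trans hk⟩
  · intro y hy hlt
    obtain ⟨x, -, hx, hx₁, hx₂⟩ := exists_ne_zero_neighbors σ y ∅ (by simp; omega)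
    refine ⟨Function.update y x 0, fun z => ?_, card_filter_update_zero y hx⟩
    by_cases hz : z = x
    · subst hz
      simpa [Function.update_of_ne (hσ z)] using hx₁
    · by_cases hz' : σ z = x
      · subst hz'
        simpa [Function.update_of_ne hz] using hx₂
      · simpa [Function.update_of_ne hz, Function.update_of_ne hz'] using hy z

/-- The orbit of `u₁` followed until it first returns to `u₁` or `u₂`. -/
theorem exists_arc {α : Type*} [Fintype α] [DecidableEq α] (σ : Equiv.Perm α)
    {u₁ u₂ : α} (hu : u₁ ≠ u₂) :
    ∃ T : Set α, (∀ x, x ≠ u₁ → x ≠ u₂ → (σ x ∈ T ↔ x ∈ T)) ∧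
      ((u₁ ∈ T ∧ σ u₁ ∈ T ∧ u₂ ∉ T ∧ σ u₂ ∉ T) ∨
        (u₁ ∉ T ∧ σ u₁ ∈ T ∧ u₂ ∈ T ∧ σ u₂ ∉ T)) := by
  have hex : ∃ m, (σ ^ (m + 1)) u₁ = u₁ ∨ (σ ^ (m + 1)) u₁ = u₂ := by
    refine ⟨orderOf σ - 1, Or.inl ?_⟩
    rw [Nat.sub_add_cancel (orderOf_pos σ), pow_orderOf_eq_one, Equiv.Perm.one_apply]
  classical
  set m := Nat.find hex with hm
  have hspec := Nat.find_spec hex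
  have hmin : ∀ i < m, (σ ^ (i + 1)) u₁ ≠ u₁ ∧ (σ ^ (i + 1)) u₁ ≠ u₂ := fun i hi => by
    simpa [not_or] using Nat.find_min hex hi
  rw [← hm] at hspec
  have hsucc : ∀ i, σ ((σ ^ i) u₁) = (σ ^ (i + 1)) u₁ := fun i => by
    rw [pow_succ', Equiv.Perm.mul_apply]
  set T : Set α := {x | ∃ i ≤ m, (σ ^ (i + 1)) u₁ = x} with hT
  have hσu₁ : σ u₁ ∈ T := ⟨0, Nat.zero_le _, by simp⟩
  have hend : (σ ^ (m + 1)) u₁ ∈ T := ⟨m, le_rfl, rfl⟩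
  have hlt : ∀ i ≤ m, (σ ^ (i + 1)) u₁ ≠ (σ ^ (m + 1)) u₁ → i < m := fun i hi hne =>
    lt_of_le_of_ne hi (by rintro rfl; exact hne rfl)
  have hfwd : ∀ x ∈ T, x ≠ (σ ^ (m + 1)) u₁ → σ x ∈ T := by
    rintro _ ⟨i, hi, rfl⟩ hne
    exact ⟨i + 1, hlt i hi hne, (hsucc _).symm⟩
  have hbwd : ∀ x, σ x ∈ T → x ≠ u₁ → x ∈ T := by
    rintro x ⟨i, hi, hx⟩ hne
    rw [← hsucc, σ.injective.eq_iff] at hx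
    cases i with
    | zero => exact absurd hx.symm hne
    | succ i => exact ⟨i, by omega, hx⟩
  refine ⟨T, fun x h₁ h₂ => ⟨fun h => hbwd x h h₁, fun h => hfwd x h ?_⟩, ?_⟩
  · rcases hspec with h | h <;> rw [h] <;> assumption
  · rcases hspec with h | h
    · have hu₂ : u₂ ∉ T := by
        rintro ⟨i, hi, hx⟩
        exact (hmin i (hlt i hi (by rw [hx, h]; exact hu.symm))).2 hx
      exact Or.inl ⟨h ▸ hend, hσu₁, hu₂, fun h' => hu₂ (hbwd _ h' hu.symm)⟩
    · have hu₁ : u₁ ∉ T := by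
        rintro ⟨i, hi, hx⟩
        exact (hmin i (hlt i hi (by rw [hx, h]; exact hu))).1 hx
      refine Or.inr ⟨hu₁, hσu₁, h ▸ hend, ?_⟩
      rintro ⟨i, hi, hx⟩
      rw [← hsucc, σ.injective.eq_iff] at hx
      cases i with
      | zero => exact hu hx
      | succ i => exact (hmin i (by omega)).2 hx

/-- A coloring by `ZMod 3` with a third of zeros, proper along `σ` except that the steps at
`u₁` and `u₂` are only required not to be equal and nonzero. -/
theorem exists_coloring_two_defects {α : Type*} [Fintype α] [DecidableEq α] (σ : Equiv.Perm α)
    (hσ : ∀ x, σ x ≠ x) {u₁ u₂ : α} (hu : u₁ ≠ u₂) :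
    ∃ y : α → ZMod 3, (∀ x, x ≠ u₁ → x ≠ u₂ → y (σ x) - y x ≠ 0) ∧
      (y (σ u₁) - y u₁ = 0 ∨ y (σ u₁) - y u₁ ≠ y (σ u₂) - y u₂) ∧
      #{x | y x = 0} = Fintype.card α / 3 := by
  classical
  obtain ⟨T, hT, hT'⟩ := exists_arc σ hu
  have hneg : ∀ y : α → ZMod 3, ∀ x, x ≠ u₁ → x ≠ u₂ → y (σ x) - y x ≠ 0 →
      T.piecewise (-y) y (σ x) - T.piecewise (-y) y x ≠ 0 := by
    intro y x h₁ h₂ h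
    by_cases hx : x ∈ T
    · rw [Set.piecewise_eq_of_mem _ _ _ hx, Set.piecewise_eq_of_mem _ _ _ ((hT x h₁ h₂).2 hx)]
      intro h'
      simp only [Pi.neg_apply] at h'
      exact h (by linear_combination -h')
    · rwa [Set.piecewise_eq_of_notMem _ _ _ hx,
        Set.piecewise_eq_of_notMem _ _ _ (fun h' => hx ((hT x h₁ h₂).1 h'))]
  have hcard : ∀ y : α → ZMod 3, #{x | T.piecewise (-y) y x = 0} = #{x | y x = 0} := by
    intro y
    congr 1
    ext x
    by_cases hx : x ∈ T <;> simp [hx]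
  rcases hT' with ⟨h₁, h₂, h₃, h₄⟩ | ⟨h₁, h₂, h₃, h₄⟩
  · obtain ⟨y, hy, hc⟩ := exists_proper_coloring_card_eq σ hσ _ le_rfl (by omega)
    by_cases hd : y (σ u₁) - y u₁ = y (σ u₂) - y u₂
    · refine ⟨T.piecewise (-y) y, fun x hx₁ hx₂ => hneg y x hx₁ hx₂ (hy x), Or.inr ?_,
        (hcard y).trans hc⟩
      have h0 := hy u₁
      simp only [h₁, h₂, h₃, h₄, Set.piecewise_eq_of_mem, Set.piecewise_eq_of_notMem,
        not_false_eq_true, ← hd, Pi.neg_apply]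
      generalize y (σ u₁) = p at *
      generalize y u₁ = q at *
      clear hd
      revert p q; decide
    · exact ⟨y, fun x _ _ => hy x, Or.inr hd, hc⟩
  · let V : (α → ZMod 3) → Prop := fun y => (∀ x, x ≠ u₁ → x ≠ u₂ → y (σ x) - y x ≠ 0) ∧
      (y (σ u₁) - y u₁ = 0 ∨ y (σ u₁) - y u₁ ≠ y (σ u₂) - y u₂)
    suffices h : ∃ y, V y ∧ #{x | y x = 0} = Fintype.card α / 3 by
      obtain ⟨y, ⟨hy, hy'⟩, hc⟩ := h
      exact ⟨y, hy, hy', hc⟩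
    refine exists_card_eq_of_step V (fun y => #{x | y x = 0}) _ ?_ ?_
    · obtain ⟨y, hy, hc⟩ := exists_coloring_sub_ne_card_le σ hσ
        (fun x => if x = u₁ then 1 else if x = u₂ then -1 else 0)
      refine ⟨y, ⟨fun x hx₁ hx₂ => by simpa [hx₁, hx₂] using hy x, ?_⟩, hc⟩
      have e₁ := hy u₁
      have e₂ := hy u₂
      simp only [hu.symm, if_true, if_false] at e₁ e₂
      generalize y (σ u₁) - y u₁ = p at *
      generalize y (σ u₂) - y u₂ = q at *
      clear hc hy
      revert p q; decide
    · intro y hy hlt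
      have hstep : ∀ y : α → ZMod 3, V y → 3 * #{x | y x = 0} + 2 < Fintype.card α →
          (∃ u, ∀ x, x ≠ u → x ≠ σ u → y x ≠ 0 →
            Function.update y x 0 (σ u₁) - Function.update y x 0 u₁ = 0 ∨
            Function.update y x 0 (σ u₁) - Function.update y x 0 u₁ ≠
              Function.update y x 0 (σ u₂) - Function.update y x 0 u₂) →
          ∃ y', V y' ∧ #{x | y' x = 0} = #{x | y x = 0} + 1 := by
        rintro y ⟨hy, -⟩ hlt ⟨u, hu⟩
        obtain ⟨x, hxu, hx, hx₁, hx₂⟩ := exists_ne_zero_neighbors σ y {u, σ u}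
          (by rw [card_pair (hσ u).symm]; omega)
        simp only [mem_insert, mem_singleton, not_or] at hxu
        refine ⟨Function.update y x 0, ⟨fun z hz₁ hz₂ => ?_, hu x hxu.1 hxu.2 hx⟩,
          card_filter_update_zero y hx⟩
        by_cases hz : z = x
        · subst hz
          simpa [Function.update_of_ne (hσ z)] using hx₁
        · by_cases hz' : σ z = x
          · subst hz'
            simpa [Function.update_of_ne hz] using hx₂
          · simpa [Function.update_of_ne hz, Function.update_of_ne hz'] using hy z hz₁ hz₂
      have hup : ∀ x u, x ≠ u → x ≠ σ u → Function.update y x 0 (σ u) - Function.update y x 0 u =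
          y (σ u) - y u := fun x u h h' => by
        rw [Function.update_of_ne h.symm, Function.update_of_ne h'.symm]
      have hzero : ∀ x u, (y u = 0 ∨ y (σ u) = 0) → y x ≠ 0 → (x = u ∨ x = σ u) →
          Function.update y x 0 (σ u) - Function.update y x 0 u = 0 := by
        rintro x u h hx (rfl | rfl)
        · simpa [Function.update_of_ne (hσ x)] using h.resolve_left hx
        · simpa [Function.update_of_ne (hσ u).symm] using h.resolve_right hx
      have hlt' : 3 * #{x | y x = 0} + 2 < Fintype.card α := by omega
      by_cases c₁ : y (σ u₁) - y u₁ = 0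
      · exact hstep y hy hlt' ⟨u₁, fun x h h' _ => Or.inl ((hup x u₁ h h').trans c₁)⟩
      by_cases c₂ : y (σ u₂) - y u₂ = 0
      · refine hstep y hy hlt' ⟨u₂, fun x h h' _ => ?_⟩
        rw [hup x u₂ h h', c₂]
        exact em _
      by_cases c₃ : y u₁ = 0 ∨ y (σ u₁) = 0
      · refine hstep y hy hlt' ⟨u₂, fun x h h' hx => ?_⟩
        by_cases hx₁ : x = u₁ ∨ x = σ u₁
        · exact Or.inl (hzero x u₁ c₃ hx hx₁)
        · rw [not_or] at hx₁
          rw [hup x u₂ h h', hup x u₁ hx₁.1 hx₁.2]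
          exact hy.2
      by_cases c₄ : y u₂ = 0 ∨ y (σ u₂) = 0
      · refine hstep y hy hlt' ⟨u₁, fun x h h' hx => ?_⟩
        by_cases hx₁ : x = u₂ ∨ x = σ u₂
        · rw [hzero x u₂ c₄ hx hx₁]
          exact em _
        · rw [not_or] at hx₁
          rw [hup x u₂ hx₁.1 hx₁.2, hup x u₁ h h']
          exact hy.2
      rw [not_or] at c₃ c₄
      have hopp : ∀ p q : ZMod 3, q - p ≠ 0 → p ≠ 0 → q ≠ 0 → -q - p = 0 := by decide
      have hd : T.piecewise (-y) y (σ u₁) - T.piecewise (-y) y u₁ = 0 := by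
        rw [Set.piecewise_eq_of_mem _ _ _ h₂, Set.piecewise_eq_of_notMem _ _ _ h₁]
        exact hopp _ _ c₁ c₃.1 c₃.2
      obtain ⟨y', hy', hc⟩ := hstep (T.piecewise (-y) y)
        ⟨fun x hx₁ hx₂ => hneg y x hx₁ hx₂ (hy.1 x hx₁ hx₂), Or.inl hd⟩ (by rwa [hcard])
        ⟨u₁, fun x h h' _ => Or.inl (by
          rwa [Function.update_of_ne h.symm, Function.update_of_ne h'.symm])⟩
      exact ⟨y', hy', by rw [hc, hcard]⟩

/-- There are sets of every cardinality which a given permutation enters and leaves at most once. -/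
theorem exists_card_eq_two_boundary {X : Type*} [Fintype X] [DecidableEq X] [Nonempty X]
    (τ : Equiv.Perm X) (w : ℕ) (hw : w ≤ Fintype.card X) :
    ∃ (W : Finset X) (u₁ u₂ : X), #W = w ∧ ∀ x, (if τ x ∈ W then 1 else 0 : ZMod 3) -
      (if x ∈ W then 1 else 0) = (if x = u₁ then 1 else 0) - if x = u₂ then 1 else 0 := by
  induction w with
  | zero =>
    obtain ⟨u⟩ := ‹Nonempty X›
    exact ⟨∅, u, u, rfl, fun x => by simp⟩
  | succ w ih =>
    obtain ⟨W, u₁, u₂, hW, h⟩ := ih (by omega)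
    have hins : ∀ x ∉ W, ∀ z, (if z ∈ insert x W then 1 else 0 : ZMod 3) =
        (if z ∈ W then 1 else 0) + if z = x then 1 else 0 := by
      intro x hx z
      by_cases hz : z = x
      · subst hz; simp [hx]
      · simp [hz]
    by_cases hu : u₁ = u₂
    · obtain ⟨x, hx⟩ : ∃ x, x ∉ W := by
        by_contra! hall
        rw [(eq_univ_iff_forall).2 hall, card_univ] at hW
        omega
      refine ⟨insert x W, τ.symm x, x, by rw [card_insert_of_notMem hx, hW], fun z => ?_⟩
      have hz := h z
      rw [hu, sub_self] at hz
      rw [hins x hx, hins x hx, if_congr (Equiv.eq_symm_apply τ) rfl rfl]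
      linear_combination hz
    · have hx : τ u₂ ∉ W := by
        intro hmem
        have h₂ := h u₂
        simp only [hmem, if_true, Ne.symm hu, if_false] at h₂
        split_ifs at h₂ <;> revert h₂ <;> decide
      refine ⟨insert (τ u₂) W, u₁, τ u₂, by rw [card_insert_of_notMem hx, hW], fun z => ?_⟩
      rw [hins _ hx, hins _ hx, if_congr τ.injective.eq_iff rfl rfl]
      linear_combination h z

/-- The two-boundary sets for a family of pairs of bijections, in terms of the common codomain. -/
theorem exists_card_eq_sum_indicator {κ α β : Type*} [Fintype κ] [Fintype α] [DecidableEq κ]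
    [DecidableEq α] [DecidableEq β] [Nonempty κ] [Nonempty α] (P Q : κ → α ≃ β) (w : ℕ)
    (hw : w ≤ Fintype.card κ * Fintype.card α) :
    ∃ (W : Finset (κ × α)) (b₁ b₂ : β), #W = w ∧ ∀ b,
      ∑ j, ((if (j, (P j).symm b) ∈ W then 1 else 0 : ZMod 3) -
        if (j, (Q j).symm b) ∈ W then 1 else 0) =
      (if b = b₁ then 1 else 0) - if b = b₂ then 1 else 0 := by
  obtain ⟨W, u₁, u₂, hW, h⟩ := exists_card_eq_two_boundary
    (Equiv.prodCongrRight fun j => (Q j).trans (P j).symm) w (by rwa [Fintype.card_prod])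
  refine ⟨W, Q u₁.1 u₁.2, Q u₂.1 u₂.2, hW, fun b => ?_⟩
  have hsum : ∀ u : κ × α, ∑ j, (if (j, (Q j).symm b) = u then 1 else 0 : ZMod 3) =
      if b = Q u.1 u.2 then 1 else 0 := by
    rintro ⟨j₀, a⟩
    rw [sum_eq_single j₀]
    · simp [Equiv.symm_apply_eq]
    · intro j _ hj
      simp [hj]
    · simp
  rw [← hsum, ← hsum, ← sum_sub_distrib]
  refine sum_congr rfl fun j _ => ?_
  rw [← h]
  simp

theorem exists_balanced_coloring {κ α β : Type*} [Fintype κ] [Fintype α] [DecidableEq κ]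
    [DecidableEq α] [DecidableEq β] (P Q : Option κ → α ≃ β) (hPQ : ∀ i a, P i a ≠ Q i a) :
    ∃ y : Option κ × α → ZMod 3,
      #{x | y x = 0} = ((Fintype.card κ + 1) * Fintype.card α + 1) / 3 ∧
      ∀ b, ∑ i, (y (i, (P i).symm b) - y (i, (Q i).symm b)) ≠ 0 := by
  let σ : Equiv.Perm α := (Q none).trans (P none).symm
  have hσ : ∀ x, σ x ≠ x := fun x h => hPQ none x (by
    rw [Equiv.trans_apply, Equiv.symm_apply_eq] at h
    exact h.symm)
  have hσQ : ∀ b, σ ((Q none).symm b) = (P none).symm b := fun b => by simp [σ]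
  have hcomb : ∀ (y₁ : κ × α → ZMod 3) (y₂ : α → ZMod 3),
      #{x | y₁ x = 0} + #{x | y₂ x = 0} =
        ((Fintype.card κ + 1) * Fintype.card α + 1) / 3 →
      (∀ b, (y₂ (σ ((Q none).symm b)) - y₂ ((Q none).symm b)) +
        ∑ j, (y₁ (j, (P (some j)).symm b) - y₁ (j, (Q (some j)).symm b)) ≠ 0) →
      ∃ y : Option κ × α → ZMod 3,
        #{x | y x = 0} = ((Fintype.card κ + 1) * Fintype.card α + 1) / 3 ∧
        ∀ b, ∑ i, (y (i, (P i).symm b) - y (i, (Q i).symm b)) ≠ 0 := by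
    intro y₁ y₂ hc hs
    refine ⟨fun x => x.1.elim (y₂ x.2) fun j => y₁ (j, x.2), ?_, fun b => ?_⟩
    · rw [← hc]
      simp only [card_filter, Fintype.sum_prod_type, Fintype.sum_option, Option.elim_none,
        Option.elim_some]
      exact add_comm _ _
    · have hb := hs b
      rw [hσQ] at hb
      rwa [Fintype.sum_option]
  rcases isEmpty_or_nonempty α with hα | hα
  · exact hcomb 0 0 (by simp) fun b => isEmptyElim ((P none).symm b)
  rcases isEmpty_or_nonempty κ with hκ | hκ
  · obtain ⟨y, hy, hc⟩ := exists_proper_coloring_card_eq σ hσ ((Fintype.card α + 1) / 3)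
      (by omega) (by omega)
    exact hcomb 0 y (by simp [hc]) fun b => by simpa using hy _
  have hle : Fintype.card α ≤ Fintype.card κ * Fintype.card α :=
    Nat.le_mul_of_pos_left _ Fintype.card_pos
  have hpos : 0 < Fintype.card α := Fintype.card_pos
  have hmul : (Fintype.card κ + 1) * Fintype.card α =
    Fintype.card κ * Fintype.card α + Fintype.card α := by ring
  obtain ⟨W, b₁, b₂, hW, h⟩ := exists_card_eq_sum_indicator (fun j => P (some j))
    (fun j => Q (some j))
    (((Fintype.card κ + 1) * Fintype.card α + 1) / 3 - Fintype.card α / 3) (by omega)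
  have hcomb' : ∀ (ε : ZMod 3) (y₂ : α → ZMod 3), ε ≠ 0 →
      #{x | y₂ x = 0} = Fintype.card α / 3 →
      (∀ b, (y₂ (σ ((Q none).symm b)) - y₂ ((Q none).symm b)) -
        ε * ((if b = b₁ then 1 else 0) - if b = b₂ then 1 else 0) ≠ 0) →
      ∃ y : Option κ × α → ZMod 3,
        #{x | y x = 0} = ((Fintype.card κ + 1) * Fintype.card α + 1) / 3 ∧
        ∀ b, ∑ i, (y (i, (P i).symm b) - y (i, (Q i).symm b)) ≠ 0 := by
    intro ε y₂ hε hc hs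
    refine hcomb (fun x => ε * (1 - if x ∈ W then 1 else 0)) y₂ ?_ fun b => ?_
    · have hz : univ.filter (fun x => ε * (1 - if x ∈ W then 1 else 0) = 0) = W := by
        ext x
        by_cases hx : x ∈ W <;> simp [hx, hε]
      rw [hz, hc, hW]
      omega
    · have hb := hs b
      rw [← h b, mul_sum, sub_eq_add_neg, ← sum_neg_distrib] at hb
      convert hb using 3
      ring
  by_cases hb : b₁ = b₂
  · obtain ⟨y, hy, hc⟩ := exists_proper_coloring_card_eq σ hσ _ le_rfl (by omega)
    exact hcomb' 1 y one_ne_zero hc fun b => by simpa [hb] using hy _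
  · obtain ⟨y, hy, hd, hc⟩ := exists_coloring_two_defects σ hσ
      (u₁ := (Q none).symm b₁) (u₂ := (Q none).symm b₂) (by simpa using hb)
    have hε : ∀ p q : ZMod 3, (p = 0 ∨ p ≠ q) → ∃ ε, ε ≠ 0 ∧ p - ε ≠ 0 ∧ q + ε ≠ 0 := by decide
    obtain ⟨ε, hε, hp, hq⟩ := hε _ _ hd
    refine hcomb' ε y hε hc fun b => ?_
    by_cases h₁ : b = b₁
    · subst h₁
      simpa [hb] using hp
    · by_cases h₂ : b = b₂
      · subst h₂
        simpa [Ne.symm hb] using hq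
      · simpa [h₁, h₂] using hy _ (by simpa using h₁) (by simpa using h₂)

theorem card_filter_range_add_mod_three (m r : ℕ) :
    #{k ∈ range m | (k + r) % 3 = 0} = (r + m + 2) / 3 - (r + 2) / 3 := by
  induction m with
  | zero => simp
  | succ m ih =>
    rw [range_add_one, filter_insert]
    split_ifs with h
    · rw [card_insert_of_notMem (by simp), ih]
      omega
    · rw [ih]
      omega

/-- Choose one number from each pair `{k, 2h + 1 - k}` with prescribed residues modulo `3`. -/
theorem exists_pairing_labels {X : Type*} [Fintype X] (h : ℕ) (hX : Fintype.card X = h)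
    (y : X → ZMod 3) (hy : #{x | y x = 0} = (h + 1) / 3) :
    ∃ L : X → ℕ, (∀ x, (L x : ZMod 3) + (2 * h + 1 : ℕ) = y x) ∧
      (∀ x, 1 ≤ L x ∧ L x ≤ 2 * h) ∧
      Function.Injective fun p : X × Bool => if p.2 then L p.1 else 2 * h + 1 - L p.1 := by
  let e₀ : X ≃ Fin h := Fintype.equivFinOfCardEq hX
  let q : Fin h → Prop := fun k => (((k : ℕ) + 1 : ℕ) : ZMod 3) + (2 * h + 1 : ℕ) = 0
  have hq : Fintype.card {k // y (e₀.symm k) = 0} = Fintype.card {k // q k} := by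
    rw [Fintype.card_subtype, Fintype.card_subtype]
    have h₁ : #{k | y (e₀.symm k) = 0} = (h + 1) / 3 := by
      rw [← hy]
      exact card_equiv e₀.symm (by simp)
    have h₂ : #{k | q k} = #{k ∈ range h | (k + (2 * h + 2)) % 3 = 0} := by
      rw [card_filter, card_filter,
        ← Fin.sum_univ_eq_sum_range (fun k => if (k + (2 * h + 2)) % 3 = 0 then 1 else 0)]
      refine sum_congr rfl fun k _ => if_congr ?_ rfl rfl
      change (((k : ℕ) + 1 : ℕ) : ZMod 3) + (2 * h + 1 : ℕ) = 0 ↔ _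
      rw [← Nat.cast_add, ZMod.natCast_eq_zero_iff, Nat.dvd_iff_mod_eq_zero]
      omega
    rw [h₁, h₂, card_filter_range_add_mod_three]
    omega
  let ρ : Equiv.Perm (Fin h) := (Fintype.equivOfCardEq hq).extendSubtype
  let g : X → ℕ := fun x => (ρ (e₀ x) : ℕ) + 1
  have hg : Function.Injective g := fun a b hab =>
    (e₀.trans ρ).injective (Fin.ext (Nat.succ_injective hab))
  have hg' : ∀ x, 1 ≤ g x ∧ g x ≤ h := fun x => ⟨by simp [g], (ρ (e₀ x)).2⟩
  have hgy : ∀ x, (g x : ZMod 3) + (2 * h + 1 : ℕ) = 0 ↔ y x = 0 := by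
    intro x
    refine ⟨fun hx => ?_, fun hx => ?_⟩
    · by_contra hne
      exact (Fintype.equivOfCardEq hq).extendSubtype_not_mem (e₀ x) (by simpa using hne) hx
    · exact (Fintype.equivOfCardEq hq).extendSubtype_mem (e₀ x) (by simpa using hx)
  have hcase : ∀ p q s : ZMod 3, (p + s = 0 ↔ q = 0) → p + s ≠ q → (s - p) + s = q := by decide
  refine ⟨fun x => if (g x : ZMod 3) + (2 * h + 1 : ℕ) = y x then g x else 2 * h + 1 - g x,
    fun x => ?_, fun x => ?_, ?_⟩
  · have := hg' x
    dsimp only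
    split_ifs with hx
    · exact hx
    · rw [Nat.cast_sub (by omega)]
      exact hcase _ _ _ (hgy x) hx
  · have := hg' x
    dsimp only
    split_ifs <;> omega
  · rintro ⟨x, i⟩ ⟨x', i'⟩ hxx
    have h₁ := hg' x
    have h₂ := hg' x'
    have hx : g x = g x' := by
      dsimp only at hxx
      split_ifs at hxx <;> omega
    obtain rfl := hg hx
    rw [Prod.mk.injEq]
    refine ⟨rfl, ?_⟩
    dsimp only at hxx
    cases i <;> cases i' <;> first | rfl | (exfalso; simp at hxx; split_ifs at hxx <;> omega)

theorem stmt_12 {V : Type*} [Fintype V] [DecidableEq V] (G : SimpleGraph V)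
    [DecidableRel G.Adj] (l n : ℕ) (A B : Finset V)
    (hdisj : Disjoint A B) (hcover : A ∪ B = Finset.univ)
    (hbip : ∀ u v, G.Adj u v → (u ∈ A ↔ v ∈ B))
    (hA : A.card = n) (hB : B.card = n)
    (hreg : G.IsRegularOfDegree (2 * l + 2)) :
    ∃ t : ℕ, ∃ f : Sym2 V → ℕ,
      Set.BijOn f ↑G.edgeFinset ↑(Finset.Icc 1 ((2 * l + 2) * n)) ∧
      (∀ a ∈ A, vertexSum G f a = t) ∧
      ∀ v ∈ B, vertexSum G f v % 3 ≠ t % 3 := by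
  have hcA : Fintype.card A = n := by rw [Fintype.card_coe, hA]
  have hcB : Fintype.card B = n := by rw [Fintype.card_coe, hB]
  have hAB : ∀ v, v ∈ A → v ∉ B := fun v h => disjoint_left.1 hdisj h
  have hor : ∀ v, v ∈ A ∨ v ∈ B := fun v => mem_union.1 (hcover ▸ mem_univ v)
  have hdegA : ∀ a : A, #{b : B | G.Adj a b} = 2 * l + 2 := by
    intro a
    rw [← hreg a, ← G.card_neighborFinset_eq_degree, ← card_map (Function.Embedding.subtype _)]
    congr 1
    ext v
    simp only [mem_map, mem_filter, mem_univ, true_and, Function.Embedding.subtype_apply,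
      SimpleGraph.mem_neighborFinset]
    exact ⟨by rintro ⟨b, hb, rfl⟩; exact hb, fun h => ⟨⟨v, (hbip a v h).1 a.2⟩, h, rfl⟩⟩
  have hdegB : ∀ b : B, #{a : A | G.Adj a b} = 2 * l + 2 := by
    intro b
    rw [← hreg b, ← G.card_neighborFinset_eq_degree, ← card_map (Function.Embedding.subtype _)]
    congr 1
    ext v
    simp only [mem_map, mem_filter, mem_univ, true_and, Function.Embedding.subtype_apply,
      SimpleGraph.mem_neighborFinset]
    exact ⟨by rintro ⟨a, ha, rfl⟩; exact ha.symm,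
      fun h => ⟨⟨v, (hbip v b h.symm).2 b.2⟩, h.symm, rfl⟩⟩
  obtain ⟨π', hπ', hπR'⟩ := exists_equiv_decomposition (hcA.trans hcB.symm) (2 * l + 2)
    (fun (a : A) (b : B) => G.Adj a b) hdegA hdegB
  let J := Option (Fin l) × Bool
  have hJ : Fintype.card J = 2 * l + 2 := by simp [J]; ring
  let ι : J ≃ Fin (2 * l + 2) := Fintype.equivFinOfCardEq hJ
  let π : J → A ≃ B := fun j => π' (ι j)
  have hπ : ∀ a j j', π j a = π j' a → j = j' := fun a j j' h => ι.injective (hπ' a h)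
  have hπR : ∀ (a : A) (b : B), G.Adj a b ↔ ∃ j, π j a = b := fun a b => by
    rw [hπR' a b, ι.exists_congr_left]
    simp [π]
  obtain ⟨y, hy0, hy⟩ := exists_balanced_coloring (fun i => π (i, true)) (fun i => π (i, false))
    (fun i a h => Bool.noConfusion (Prod.mk.inj (hπ a _ _ h)).2)
  rw [Fintype.card_fin, hcA] at hy0
  obtain ⟨L, hLy, hLle, hLinj⟩ := exists_pairing_labels ((l + 1) * n)
    (by simp [hA]) y hy0
  set s := 2 * ((l + 1) * n) + 1 with hs
  let label : J × A → ℕ := fun p =>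
    if p.1.2 then L (p.1.1, p.2) else s - L (p.1.1, p.2)
  have hlabel : Function.Injective label := by
    rintro ⟨⟨i, c⟩, a⟩ ⟨⟨i', c'⟩, a'⟩ h
    have := @hLinj ((i, a), c) ((i', a'), c') h
    obtain ⟨⟨rfl, rfl⟩, rfl⟩ := by simpa only [Prod.mk.injEq] using this
    rfl
  let E : J × A → Sym2 V := fun p => s((p.2 : V), (π p.1 p.2 : V))
  have hEeq : ∀ p q, E p = E q ↔ p = q := by
    rintro ⟨j, a⟩ ⟨j', a'⟩
    refine ⟨fun h => ?_, congrArg E⟩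
    rcases Sym2.eq_iff.1 h with ⟨h₁, h₂⟩ | ⟨h₁, -⟩
    · obtain rfl := Subtype.ext h₁
      rw [hπ a j j' (Subtype.ext h₂)]
    · exact absurd (π j' a').2 (hAB _ (by rw [← h₁]; exact a.2))
  have hE : Function.Injective E := fun p q => (hEeq p q).1
  have hEadj : ∀ j (a : A), G.Adj (a : V) (π j a : V) := fun j a => (hπR a _).2 ⟨j, rfl⟩
  let f : Sym2 V → ℕ := Function.extend E label 0
  have hf : ∀ p, f (E p) = label p := fun p => hE.extend_apply _ _ _
  have hedge : G.edgeFinset = univ.image E := by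
    ext e
    induction e using Sym2.ind with
    | _ u v =>
      rw [SimpleGraph.mem_edgeFinset, SimpleGraph.mem_edgeSet, mem_image]
      constructor
      · intro h
        rcases hor u with hu | hu
        · obtain ⟨j, hj⟩ := (hπR ⟨u, hu⟩ ⟨v, (hbip u v h).1 hu⟩).1 h
          exact ⟨(j, ⟨u, hu⟩), mem_univ _, by simp [E, hj]⟩
        · have hv := (hbip v u h.symm).2 hu
          obtain ⟨j, hj⟩ := (hπR ⟨v, hv⟩ ⟨u, hu⟩).1 h.symm
          exact ⟨(j, ⟨v, hv⟩), mem_univ _, by simp [E, hj, Sym2.eq_swap]⟩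
      · rintro ⟨⟨j, a⟩, -, h⟩
        rw [← SimpleGraph.mem_edgeSet, ← h]
        exact hEadj j a
  have hlabel_mem : ∀ p, label p ∈ Icc 1 ((2 * l + 2) * n) := by
    intro p
    have h := hLle (p.1.1, p.2)
    have hm : (2 * l + 2) * n = 2 * ((l + 1) * n) := by ring
    rw [mem_Icc, hm]
    dsimp only [label]
    split_ifs <;> omega
  have himage : univ.image label = Icc 1 ((2 * l + 2) * n) := by
    refine eq_of_subset_of_card_le (fun k hk => ?_) ?_
    · obtain ⟨p, -, rfl⟩ := mem_image.1 hk
      exact hlabel_mem p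
    · rw [card_image_of_injective _ hlabel, card_univ, Fintype.card_prod, hJ, hcA, Nat.card_Icc,
        Nat.add_sub_cancel]
  have hsumA : ∀ a : A, vertexSum G f a = ∑ j, label (j, a) := by
    intro a
    have hinc : G.incidenceFinset (a : V) = univ.image fun j => E (j, a) := by
      ext e
      rw [SimpleGraph.incidenceFinset_eq_filter, hedge]
      simp only [mem_filter, mem_image, mem_univ, true_and, Prod.exists]
      constructor
      · rintro ⟨⟨j, a', rfl⟩, h⟩
        rcases Sym2.mem_iff.1 h with h | h
        · exact ⟨j, by rw [Subtype.ext h]⟩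
        · exact absurd (π j a').2 (hAB _ (h ▸ a.2))
      · rintro ⟨j, rfl⟩
        exact ⟨⟨j, a, rfl⟩, Sym2.mem_mk_left _ _⟩
    rw [vertexSum, hinc, sum_image fun j _ j' _ h => (Prod.mk.inj (hE h)).1]
    exact sum_congr rfl fun j _ => hf _
  have hsumB : ∀ b : B, vertexSum G f b = ∑ j, label (j, (π j).symm b) := by
    intro b
    have hinc : G.incidenceFinset (b : V) = univ.image fun j => E (j, (π j).symm b) := by
      ext e
      rw [SimpleGraph.incidenceFinset_eq_filter, hedge]
      simp only [mem_filter, mem_image, mem_univ, true_and, Prod.exists]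
      constructor
      · rintro ⟨⟨j, a', rfl⟩, h⟩
        rcases Sym2.mem_iff.1 h with h | h
        · exact absurd b.2 (hAB _ (by rw [h]; exact a'.2))
        · exact ⟨j, by rw [Subtype.ext h, Equiv.symm_apply_apply]⟩
      · rintro ⟨j, rfl⟩
        refine ⟨⟨j, _, rfl⟩, ?_⟩
        simp [E]
    rw [vertexSum, hinc, sum_image fun j _ j' _ h => (Prod.mk.inj (hE h)).1]
    exact sum_congr rfl fun j _ => hf _
  refine ⟨(l + 1) * s, f, ⟨?_, ?_, ?_⟩, ?_, ?_⟩
  · intro e he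
    rw [mem_coe, hedge] at he
    obtain ⟨p, -, rfl⟩ := mem_image.1 he
    rw [hf]
    exact hlabel_mem p
  · intro e he e' he' h
    rw [mem_coe, hedge] at he he'
    obtain ⟨p, -, rfl⟩ := mem_image.1 he
    obtain ⟨p', -, rfl⟩ := mem_image.1 he'
    rw [hf, hf] at h
    rw [hlabel h]
  · intro k hk
    rw [mem_coe, ← himage] at hk
    obtain ⟨p, -, rfl⟩ := mem_image.1 hk
    exact ⟨E p, by rw [mem_coe, hedge]; exact mem_image_of_mem _ (mem_univ _), hf p⟩
  · intro a ha
    rw [hsumA ⟨a, ha⟩, Fintype.sum_prod_type]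
    have : ∀ i : Option (Fin l), ∑ c : Bool, label ((i, c), ⟨a, ha⟩) = s := by
      intro i
      have h := hLle (i, ⟨a, ha⟩)
      rw [Fintype.sum_bool]
      simp only [label, if_true, Bool.false_eq_true, if_false]
      omega
    rw [sum_congr rfl fun i _ => this i]
    simp
  · intro b hb hmod
    rw [hsumB ⟨b, hb⟩, Fintype.sum_prod_type] at hmod
    have hcast := (ZMod.natCast_eq_natCast_iff _ _ 3).2 hmod
    refine hy ⟨b, hb⟩ ?_
    have : ∀ i : Option (Fin l),
        ((∑ c : Bool, label ((i, c), (π (i, c)).symm ⟨b, hb⟩) : ℕ) : ZMod 3) =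
        (y (i, (π (i, true)).symm ⟨b, hb⟩) - y (i, (π (i, false)).symm ⟨b, hb⟩)) + s := by
      intro i
      have h := hLle (i, (π (i, false)).symm ⟨b, hb⟩)
      rw [Fintype.sum_bool, ← hLy, ← hLy]
      simp only [label, if_true, Bool.false_eq_true, if_false]
      rw [Nat.cast_add, Nat.cast_sub (by omega)]
      ring
    rw [Nat.cast_sum, sum_congr rfl fun i _ => this i, sum_add_distrib] at hcast
    simpa using hcast
end

section
/- Every 4-regular bipartite graph is antimagic. -/
open Finset

open Function

theorem exists_injective_of_regular {A B : Type*} [Fintype A] [DecidableEq B]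
    {k : ℕ} (hk : 0 < k) (N : A → Finset B) (hA : ∀ a, #(N a) = k)
    (hB : ∀ b, #{a | b ∈ N a} = k) : ∃ m : A → B, Injective m ∧ ∀ a, m a ∈ N a := by
  classical
  refine (Finset.all_card_le_biUnion_card_iff_exists_injective N).1 fun s => ?_
  have h := Finset.sum_card_bipartiteAbove_eq_sum_card_bipartiteBelow
    (s := s) (t := s.biUnion N) (fun a b => b ∈ N a)
  have h1 : ∀ a ∈ s, #((s.biUnion N).bipartiteAbove (fun a b => b ∈ N a) a) = k := by
    intro a ha
    rw [← hA a]
    congr 1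
    ext b
    simp only [Finset.mem_bipartiteAbove, Finset.mem_biUnion]
    exact ⟨fun h => h.2, fun h => ⟨⟨a, ha, h⟩, h⟩⟩
  have h2 : ∀ b ∈ s.biUnion N, #(s.bipartiteBelow (fun a b => b ∈ N a) b) ≤ k := by
    intro b _
    rw [← hB b]
    refine Finset.card_le_card fun a ha => ?_
    simpa using (Finset.mem_bipartiteBelow _ |>.1 ha).2
  rw [Finset.sum_congr rfl h1, Finset.sum_const, smul_eq_mul] at h
  have h3 := Finset.sum_le_card_nsmul _ _ _ h2
  rw [← h, smul_eq_mul] at h3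
  exact Nat.le_of_mul_le_mul_right h3 hk

theorem card_eq_of_regular {A B : Type*} [Fintype A] [Fintype B] [DecidableEq B]
    {k : ℕ} (hk : 0 < k) (N : A → Finset B) (hA : ∀ a, #(N a) = k)
    (hB : ∀ b, #{a | b ∈ N a} = k) : Fintype.card A = Fintype.card B := by
  have h := Finset.sum_card_bipartiteAbove_eq_sum_card_bipartiteBelow
    (s := (univ : Finset A)) (t := (univ : Finset B)) (fun a b => b ∈ N a)
  simp only [Finset.bipartiteAbove, Finset.bipartiteBelow, hB, Finset.filter_mem_eq_inter,
    Finset.univ_inter, hA, Finset.sum_const, smul_eq_mul, Finset.card_univ] at h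
  exact Nat.eq_of_mul_eq_mul_right hk h

/-- The neighbours `a` of `b` whose selected edge `e a` does not lead to `b`. -/
def unselected {A B : Type*} [Fintype A] [DecidableEq B] (N : A → Finset B) (e : A → B)
    (b : B) : Finset A := {a | b ∈ N a ∧ e a ≠ b}

/-- The unselected edges at the vertices of `S` form cycles. -/
def IsCycleUnion {A B : Type*} [Fintype A] [DecidableEq B] (N : A → Finset B) (e : A → B)
    (S : Finset A) : Prop :=
  ∀ a ∈ S, ∀ b ∈ N a, e a ≠ b → #(unselected N e b) = 2 ∧ unselected N e b ⊆ S

theorem mem_unselected {A B : Type*} [Fintype A] [DecidableEq B] {N : A → Finset B} {e : A → B}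
    {b : B} {a : A} : a ∈ unselected N e b ↔ b ∈ N a ∧ e a ≠ b := by
  simp [unselected]

theorem unselected_update_of_ne {A B : Type*} [Fintype A] [DecidableEq A] [DecidableEq B]
    {N : A → Finset B} {e : A → B} {a : A} {b d : B} (hd : d ≠ b) (hd' : d ≠ e a) :
    unselected N (update e a b) d = unselected N e d := by
  ext x
  by_cases hx : x = a
  · subst hx
    simp [mem_unselected, hd.symm, hd'.symm]
  · simp [mem_unselected, hx]

theorem unselected_update_self {A B : Type*} [Fintype A] [DecidableEq A] [DecidableEq B]
    {N : A → Finset B} {e : A → B} {a : A} {b : B} :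
    unselected N (update e a b) b = (unselected N e b).erase a := by
  ext x
  by_cases hx : x = a
  · subst hx
    simp [mem_unselected]
  · simp [mem_unselected, hx]

theorem unselected_subset_update {A B : Type*} [Fintype A] [DecidableEq A] [DecidableEq B]
    {N : A → Finset B} {e : A → B} {a : A} {b d : B} (hd : d ≠ b) :
    unselected N e d ⊆ unselected N (update e a b) d := by
  intro x
  by_cases hx : x = a
  · subst hx
    simp +contextual [mem_unselected, hd.symm]
  · simp [mem_unselected, hx]

theorem notMem_of_isCycleUnion_update {A B : Type*} [Fintype A] [Fintype B] [DecidableEq A]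
    [DecidableEq B] {N : A → Finset B} {e : A → B} (hN : ∀ a, #(N a) = 3) (he : ∀ a, e a ∈ N a)
    {a : A} {b : B} (hb : b ∈ N a) (hab : e a ≠ b) {Z S : Finset A} (hZ : IsCycleUnion N e Z)
    (haZ : a ∈ Z) (hS : IsCycleUnion N (update e a b) S) : a ∉ S := by
  intro haS
  have hcard : #(unselected N (update e a b) b) = 1 := by
    rw [unselected_update_self, Finset.card_erase_of_mem (mem_unselected.2 ⟨hb, hab⟩),
      (hZ a haZ b hb hab).1]
  have hbS : ∀ x ∈ unselected N e b, x ≠ a → x ∉ S := by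
    intro x hx hxa hxS
    rw [mem_unselected] at hx
    have := (hS x hxS b hx.1 (by simpa [hxa] using hx.2)).1
    omega
  have hcount := Finset.sum_card_bipartiteAbove_eq_sum_card_bipartiteBelow
    (s := Z \ S) (t := (univ : Finset B)) (fun a b => b ∈ N a ∧ e a ≠ b)
  have hl : ∀ x ∈ Z \ S, #((univ : Finset B).bipartiteAbove (fun a b => b ∈ N a ∧ e a ≠ b) x)
      = 2 := by
    intro x _
    have : (univ : Finset B).bipartiteAbove (fun a b => b ∈ N a ∧ e a ≠ b) x
        = (N x).erase (e x) := by
      ext d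
      simp [and_comm, eq_comm]
    rw [this, Finset.card_erase_of_mem (he x), hN]
  have hb1 : #((Z \ S).bipartiteBelow (fun a b => b ∈ N a ∧ e a ≠ b) b) = 1 := by
    rw [← hcard, unselected_update_self]
    congr 1
    ext x
    simp only [Finset.mem_bipartiteBelow, Finset.mem_sdiff, Finset.mem_erase]
    constructor
    · rintro ⟨⟨_, h2⟩, h3⟩
      exact ⟨fun h => h2 (h ▸ haS), mem_unselected.2 h3⟩
    · rintro ⟨h1, h2⟩
      exact ⟨⟨(hZ a haZ b hb hab).2 h2, hbS x h2 h1⟩, mem_unselected.1 h2⟩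
  have hr : ∀ d ∈ (univ : Finset B).erase b,
      Even #((Z \ S).bipartiteBelow (fun a b => b ∈ N a ∧ e a ≠ b) d) := by
    intro d hd
    have hdb : d ≠ b := Finset.ne_of_mem_erase hd
    by_cases hne : (Z \ S).bipartiteBelow (fun a b => b ∈ N a ∧ e a ≠ b) d = ∅
    · simp [hne]
    obtain ⟨x, hx⟩ := Finset.nonempty_iff_ne_empty.2 hne
    simp only [Finset.mem_bipartiteBelow, Finset.mem_sdiff] at hx
    obtain ⟨⟨hxZ, hxS⟩, hxd⟩ := hx
    obtain ⟨h2, hsub⟩ := hZ x hxZ d hxd.1 hxd.2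
    have : (Z \ S).bipartiteBelow (fun a b => b ∈ N a ∧ e a ≠ b) d = unselected N e d := by
      ext y
      simp only [Finset.mem_bipartiteBelow, Finset.mem_sdiff]
      rw [← mem_unselected]
      refine ⟨fun h => h.2, fun h => ⟨⟨hsub h, fun hyS => hxS ?_⟩, h⟩⟩
      have hy := mem_unselected.1 (unselected_subset_update (a := a) hdb h)
      exact (hS y hyS d hy.1 hy.2).2 (unselected_subset_update hdb (mem_unselected.2 hxd))
    rw [this, h2]
    exact even_two
  rw [Finset.sum_congr rfl hl, ← Finset.add_sum_erase _ _ (Finset.mem_univ b), hb1,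
    Finset.sum_const, smul_eq_mul] at hcount
  obtain ⟨t, ht⟩ := Finset.even_sum _ hr
  omega

theorem isCycleUnion_of_isCycleUnion_update {A B : Type*} [Fintype A] [DecidableEq A] [DecidableEq B]
    {N : A → Finset B} {e : A → B} (he : ∀ a, e a ∈ N a) {a : A} {b : B} (hb : b ∈ N a)
    (hab : e a ≠ b) (h2 : #(unselected N e b) = 2) {S : Finset A}
    (hS : IsCycleUnion N (update e a b) S) (haS : a ∉ S) : IsCycleUnion N e S := by
  intro x hx d hd hxd
  have hxa : x ≠ a := fun h => haS (h ▸ hx)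
  obtain ⟨h3, h4⟩ := hS x hx d hd (by simpa [hxa] using hxd)
  have hdb : d ≠ b := by
    rintro rfl
    rw [unselected_update_self, Finset.card_erase_of_mem (mem_unselected.2 ⟨hb, hab⟩)] at h3
    omega
  have hda : d ≠ e a := by
    rintro rfl
    exact haS (h4 (mem_unselected.2 ⟨he a, by simpa using hab.symm⟩))
  rw [unselected_update_of_ne hdb hda] at h3 h4
  exact ⟨h3, h4⟩

theorem exists_acyclic_selection {A B : Type*} [Fintype A] [Fintype B] [DecidableEq B]
    (N : A → Finset B) (hA : ∀ a, #(N a) = 3) (hB : ∀ b, #{a | b ∈ N a} = 3) :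
    ∃ e : A → B, (∀ a, e a ∈ N a) ∧ (∀ b, (unselected N e b).Nonempty) ∧
      ∀ S, IsCycleUnion N e S → S = ∅ := by
  classical
  let P : (A → B) → Prop := fun e => (∀ a, e a ∈ N a) ∧ ∀ b, (unselected N e b).Nonempty
  let μ : (A → B) → ℕ := fun e => #{a | ∃ S, IsCycleUnion N e S ∧ a ∈ S}
  have h0 : ∃ e, P e := by
    obtain ⟨e, hinj, he⟩ := exists_injective_of_regular (by norm_num) N hA hB
    refine ⟨e, he, fun b => ?_⟩
    obtain ⟨x, y, hx, hy, hxy⟩ := Finset.one_lt_card_iff.1 (show 1 < #{a | b ∈ N a} by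
      rw [hB]; norm_num)
    simp only [Finset.mem_filter, Finset.mem_univ, true_and] at hx hy
    by_cases hxb : e x = b
    · exact ⟨y, mem_unselected.2 ⟨hy, fun h => hxy (hinj (hxb.trans h.symm))⟩⟩
    · exact ⟨x, mem_unselected.2 ⟨hx, hxb⟩⟩
  obtain ⟨e, ⟨he, hne⟩, hmin⟩ : ∃ e, P e ∧ ∀ e', P e' → μ e ≤ μ e' := by
    obtain ⟨e, heP, hmin⟩ := Set.exists_min_image {e | P e} μ (Set.toFinite _) h0
    exact ⟨e, heP, hmin⟩
  refine ⟨e, he, hne, fun Z hZ => ?_⟩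
  by_contra hZne
  obtain ⟨a, ha⟩ := Finset.nonempty_iff_ne_empty.2 hZne
  obtain ⟨b, hb⟩ : ((N a).erase (e a)).Nonempty := by
    rw [← Finset.card_pos, Finset.card_erase_of_mem (he a), hA]
    norm_num
  have hab : e a ≠ b := (Finset.ne_of_mem_erase hb).symm
  replace hb := Finset.mem_of_mem_erase hb
  have h2 := (hZ a ha b hb hab).1
  refine absurd (hmin (update e a b) ⟨fun x => ?_, fun d => ?_⟩) (not_le.2 ?_)
  · by_cases hx : x = a
    · subst hx
      simpa using hb
    · simpa [hx] using he x
  · by_cases hd : d = b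
    · subst hd
      rw [← Finset.card_pos, unselected_update_self,
        Finset.card_erase_of_mem (mem_unselected.2 ⟨hb, hab⟩), h2]
      norm_num
    · exact (hne d).mono (unselected_subset_update hd)
  · refine Finset.card_lt_card ((Finset.ssubset_iff_of_subset ?_).2 ⟨a, ?_, ?_⟩)
    · intro x hx
      simp only [Finset.mem_filter, Finset.mem_univ, true_and] at hx ⊢
      obtain ⟨S, hS, hxS⟩ := hx
      exact ⟨S, isCycleUnion_of_isCycleUnion_update he hb hab h2 hS
        (notMem_of_isCycleUnion_update hA he hb hab hZ ha hS), hxS⟩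
    · simpa using ⟨Z, hZ, ha⟩
    · simpa using fun S hS => notMem_of_isCycleUnion_update hA he hb hab hZ ha hS

theorem exists_orientation {A B : Type*} [Fintype A] [DecidableEq B] {N : A → Finset B}
    {e : A → B} (hN : ∀ a, #(N a) = 3) (he : ∀ a, e a ∈ N a)
    (hcyc : ∀ S, IsCycleUnion N e S → S = ∅) (t : A → Bool) (S : Finset A) :
    ∃ g : A → B, (∀ a, g a ∈ N a ∧ e a ≠ g a) ∧
      ∀ b, #(unselected N e b) = 2 → ∀ a ∈ unselected N e b, ∀ a' ∈ unselected N e b,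
        a ≠ a' → a ∈ S → a' ∈ S → ((g a = b ↔ g a' = b) ↔ t a = t a') := by
  classical
  have htwo : ∀ a, ∃ x y, x ≠ y ∧ (N a).erase (e a) = {x, y} := fun a =>
    Finset.card_eq_two.1 (by rw [Finset.card_erase_of_mem (he a), hN])
  induction S using Finset.strongInduction with
  | H S ih =>
    by_cases hS : S = ∅
    · subst hS
      choose x y hxy hx using htwo
      have hmem : ∀ a, x a ∈ (N a).erase (e a) := fun a => by simp [hx a]
      exact ⟨x, fun a => ⟨Finset.mem_of_mem_erase (hmem a),
        (Finset.ne_of_mem_erase (hmem a)).symm⟩, by simp⟩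
    have hnc : ¬ IsCycleUnion N e S := fun h => hS (hcyc S h)
    unfold IsCycleUnion at hnc
    push Not at hnc
    obtain ⟨a, haS, b, hb, hab, hfree⟩ := hnc
    obtain ⟨g, hg, hgS⟩ := ih (S.erase a) (Finset.erase_ssubset haS)
    -- `d` is the only unselected edge at `a` that may be constrained by the other vertices of `S`
    obtain ⟨d, hd, hbd, hall⟩ : ∃ d ∈ (N a).erase (e a), b ≠ d ∧
        ∀ z ∈ (N a).erase (e a), z = b ∨ z = d := by
      obtain ⟨x, y, hxy, hx⟩ := htwo a
      have : b ∈ (N a).erase (e a) := Finset.mem_erase.2 ⟨hab.symm, hb⟩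
      rw [hx] at this ⊢
      simp only [Finset.mem_insert, Finset.mem_singleton] at this
      rcases this with rfl | rfl
      · exact ⟨y, by simp, hxy, by simp⟩
      · exact ⟨x, by simp, hxy.symm, by simp [or_comm]⟩
    have hdN := Finset.mem_of_mem_erase hd
    have hed := (Finset.ne_of_mem_erase hd).symm
    obtain ⟨v, hv, hvd⟩ : ∃ v, (v = b ∨ v = d) ∧ ∀ a' ∈ S, a' ≠ a → a' ∈ unselected N e d →
        #(unselected N e d) = 2 → ((v = d ↔ g a' = d) ↔ t a = t a') := by
      by_cases hex : ∃ a' ∈ S, a' ≠ a ∧ a' ∈ unselected N e d ∧ #(unselected N e d) = 2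
      · obtain ⟨a', ha'S, ha'a, ha'd, hd2⟩ := hex
        have huniq : ∀ x ∈ unselected N e d, x ≠ a → x = a' := by
          intro x hx hxa
          have h1 : #((unselected N e d).erase a) = 1 := by
            rw [Finset.card_erase_of_mem (mem_unselected.2 ⟨hdN, hed⟩), hd2]
          exact Finset.card_le_one.1 h1.le x (Finset.mem_erase.2 ⟨hxa, hx⟩) a'
            (Finset.mem_erase.2 ⟨ha'a, ha'd⟩)
        by_cases hc : g a' = d ↔ t a = t a'
        · refine ⟨d, Or.inr rfl, fun x _ hxa hx _ => ?_⟩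
          rw [huniq x hx hxa]
          simpa using hc
        · refine ⟨b, Or.inl rfl, fun x _ hxa hx _ => ?_⟩
          rw [huniq x hx hxa]
          have := hbd
          tauto
      · exact ⟨b, Or.inl rfl, fun x hxS hxa hx hd2 => absurd ⟨x, hxS, hxa, hx, hd2⟩ hex⟩
    have key : ∀ z, #(unselected N e z) = 2 → a ∈ unselected N e z → ∀ x ∈ unselected N e z,
        x ∈ S → x ≠ a → ((v = z ↔ g x = z) ↔ t a = t x) := by
      intro z hz2 haz x hxz hxS hxa
      have haz' := mem_unselected.1 haz
      rcases hall z (Finset.mem_erase.2 ⟨haz'.2.symm, haz'.1⟩) with rfl | rfl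
      · refine absurd (fun y hy => ?_) (hfree hz2)
        by_cases hya : y = a
        · exact hya ▸ haS
        · have h1 : #((unselected N e z).erase a) = 1 := by
            rw [Finset.card_erase_of_mem haz, hz2]
          have := Finset.card_le_one.1 h1.le y (Finset.mem_erase.2 ⟨hya, hy⟩) x
            (Finset.mem_erase.2 ⟨hxa, hxz⟩)
          exact this ▸ hxS
      · exact hvd x hxS hxa hxz hz2
    refine ⟨update g a v, fun x => ?_, fun z hz2 x hx y hy hxy hxS hyS => ?_⟩
    · by_cases hxa : x = a
      · subst hxa
        rcases hv with rfl | rfl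
        · simpa using ⟨hb, hab⟩
        · simpa using ⟨hdN, hed⟩
      · simpa [hxa] using hg x
    · by_cases hxa : x = a
      · subst hxa
        simpa [hxy.symm] using key z hz2 hx y hy hyS hxy.symm
      · by_cases hya : y = a
        · subst hya
          have := key z hz2 hy x hx hxS hxa
          simp only [update_self, ne_eq, hxa, not_false_eq_true, update_of_ne]
          rw [eq_comm (a := t x), ← this]
          tauto
        · simpa [hxa, hya] using hgS z hz2 x hx y hy hxy (Finset.mem_erase.2 ⟨hxa, hxS⟩)
            (Finset.mem_erase.2 ⟨hya, hyS⟩)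

/-- A finite linear forest on evenly many vertices has a balanced proper `2`-colouring. -/
theorem exists_balanced_coloring_s14 {A : Type*} [DecidableEq A] (R : A → A → Prop)
    (hirr : ∀ a, ¬ R a a) (hsymm : ∀ a b, R a b → R b a)
    (hdeg : ∀ a, ∃ u v, ∀ x, R a x → x = u ∨ x = v)
    (hleaf : ∀ S : Finset A, S.Nonempty → ∃ a ∈ S, ∃ u, ∀ x ∈ S, R a x → x = u)
    (S : Finset A) (hS : Even #S) :
    ∃ s : A → Bool, (∀ a ∈ S, ∀ b ∈ S, R a b → s a ≠ s b) ∧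
      #{a ∈ S | s a = true} = #{a ∈ S | s a = false} := by
  induction S using Finset.strongInduction with
  | H S ih =>
    by_cases hne : S.Nonempty
    swap
    · rw [Finset.not_nonempty_iff_eq_empty] at hne
      subst hne
      exact ⟨fun _ => true, by simp, by simp⟩
    -- two vertices which together see at most one further vertex
    obtain ⟨a, haS, b, hbS, hab, u, hau, hbu⟩ : ∃ a ∈ S, ∃ b ∈ S, a ≠ b ∧
        ∃ u, (∀ x ∈ S, R a x → x = b) ∧ ∀ x ∈ S, R b x → x = a ∨ x = u := by
      obtain ⟨a, haS, w, hw⟩ := hleaf S hne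
      by_cases hex : ∃ x ∈ S, R a x
      · obtain ⟨b, hbS, hb⟩ := hex
        obtain ⟨u, v, huv⟩ := hdeg b
        have hwb := hw b hbS hb
        subst hwb
        have hab : a ≠ b := fun h => hirr a (by rw [← h] at hb; exact hb)
        rcases huv a (hsymm _ _ hb) with rfl | rfl
        · exact ⟨a, haS, b, hbS, hab, v, hw, fun x _ hx => huv x hx⟩
        · exact ⟨a, haS, b, hbS, hab, u, hw, fun x _ hx => (huv x hx).symm⟩
      · have hne' : (S.erase a).Nonempty := by
          rw [← Finset.card_pos, Finset.card_erase_of_mem haS]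
          have := Finset.card_pos.2 hne
          obtain ⟨k, hk⟩ := hS
          omega
        obtain ⟨b, hb, u, hu⟩ := hleaf _ hne'
        refine ⟨a, haS, b, Finset.mem_of_mem_erase hb, (Finset.ne_of_mem_erase hb).symm, u,
          fun x hx hax => absurd ⟨x, hx, hax⟩ hex, fun x hx hbx => ?_⟩
        by_cases hxa : x = a
        · exact Or.inl hxa
        · exact Or.inr (hu x (Finset.mem_erase.2 ⟨hxa, hx⟩) hbx)
    set T := (S.erase a).erase b with hT
    have hbSa : b ∈ S.erase a := Finset.mem_erase.2 ⟨hab.symm, hbS⟩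
    have hTS : insert a (insert b T) = S := by
      rw [hT, Finset.insert_erase hbSa, Finset.insert_erase haS]
    have haT : a ∉ T := by simp [hT]
    have hbT : b ∉ T := by simp [hT]
    have hTcard : Even #T := by
      rw [hT, Finset.card_erase_of_mem hbSa, Finset.card_erase_of_mem haS]
      obtain ⟨k, hk⟩ := hS
      exact ⟨k - 1, by omega⟩
    obtain ⟨s, hs, hbal⟩ := ih T
      ((Finset.erase_ssubset hbSa).trans (Finset.erase_ssubset haS)) hTcard
    let s' := update (update s b (!s u)) a (s u)
    have hs'a : s' a = s u := by simp [s']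
    have hs'b : s' b = !s u := by simp [s', hab.symm]
    have hs'T : ∀ x ∈ T, s' x = s x := by
      intro x hx
      have h1 : x ≠ a := fun h => haT (h ▸ hx)
      have h2 : x ≠ b := fun h => hbT (h ▸ hx)
      simp [s', h1, h2]
    have hcases : ∀ x ∈ S, x = a ∨ x = b ∨ x ∈ T := by
      intro x hx
      simpa [← hTS] using hx
    have ha : ∀ x ∈ S, R a x → s' a ≠ s' x := by
      intro x hx hax
      rw [hau x hx hax, hs'a, hs'b]
      simp
    have hb : ∀ x ∈ S, R b x → s' b ≠ s' x := by
      intro x hx hbx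
      rcases hcases x hx with rfl | rfl | hxT
      · simp [hs'a, hs'b]
      · exact absurd hbx (hirr _)
      · rcases hbu x hx hbx with rfl | rfl
        · exact absurd hxT haT
        · simp [hs'b, hs'T x hxT]
    refine ⟨s', fun x hx y hy hxy => ?_, ?_⟩
    · rcases hcases x hx with rfl | rfl | hxT
      · exact ha y hy hxy
      · exact hb y hy hxy
      · rcases hcases y hy with rfl | rfl | hyT
        · exact (ha x hx (hsymm _ _ hxy)).symm
        · exact (hb x hx (hsymm _ _ hxy)).symm
        · rw [hs'T x hxT, hs'T y hyT]
          exact hs x hxT y hyT hxy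
    · have hfil : ∀ c, #{x ∈ T | s' x = c} = #{x ∈ T | s x = c} := fun c => by
        rw [Finset.filter_congr fun x hx => by rw [hs'T x hx]]
      have haT' : ∀ c, a ∉ ({x ∈ T | s' x = c} : Finset A) := fun c h =>
        haT (Finset.mem_filter.1 h).1
      have hbT' : ∀ c, b ∉ ({x ∈ T | s' x = c} : Finset A) := fun c h =>
        hbT (Finset.mem_filter.1 h).1
      rw [← hTS]
      simp only [Finset.filter_insert, hs'a, hs'b]
      cases s u <;> simp [haT', hbT', Finset.card_insert_of_notMem, hfil, hbal]

/-- A balanced `2`-colouring is the parity of some numbering by `1, …, |A|`. -/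
theorem exists_numbering_of_balanced {A : Type*} [Fintype A] (s : A → Bool)
    (hs : #{a | s a = true} = #{a | s a = false}) :
    ∃ j : A → ℕ, Injective j ∧ (∀ a, 1 ≤ j a ∧ j a ≤ Fintype.card A) ∧
      ∀ a b, s a ≠ s b → j a % 2 ≠ j b % 2 := by
  classical
  set k := #{a | s a = true} with hk
  have hcard : Fintype.card A = 2 * k := by
    have := Finset.card_filter_add_card_filter_not (s := (univ : Finset A)) (fun a => s a = true)
    simp only [Bool.not_eq_true, Finset.card_univ] at this
    omega
  have hinj : ∀ c, ∃ f : A → ℕ, (∀ a, s a = c → f a < k) ∧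
      ∀ a b, s a = c → s b = c → f a = f b → a = b := by
    intro c
    have hc : #{a | s a = c} = k := by cases c <;> omega
    let φ := Finset.equivFinOfCardEq hc
    refine ⟨fun a => if h : s a = c then φ ⟨a, by simpa using h⟩ else 0, fun a ha => ?_,
      fun a b ha hb hab => ?_⟩
    · simp [ha]
    · simp only [ha, hb, dite_true] at hab
      simpa using φ.injective (Fin.ext hab)
  obtain ⟨f, hf, hf'⟩ := hinj true
  obtain ⟨g, hg, hg'⟩ := hinj false
  refine ⟨fun a => if s a = true then 2 * f a + 1 else 2 * g a + 2, fun a b hab => ?_,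
    fun a => ?_, fun a b hab => ?_⟩
  · cases ha : s a <;> cases hb : s b <;> simp only [ha, hb] at hab
    · exact hg' a b ha hb (by simpa using hab)
    · simp at hab; omega
    · simp at hab; omega
    · exact hf' a b ha hb (by simpa using hab)
  · cases ha : s a
    · have := hg a ha
      simp only [ha, Bool.false_eq_true, if_false]
      omega
    · have := hf a ha
      simp only [ha, if_true]
      omega
  · cases ha : s a <;> cases hb : s b <;> simp [ha, hb] at hab ⊢

theorem exists_numbering_orientation {A B : Type*} [Fintype A] [DecidableEq B]
    {N : A → Finset B} {e : A → B} (hN : ∀ a, #(N a) = 3) (he : ∀ a, e a ∈ N a)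
    (hcyc : ∀ S, IsCycleUnion N e S → S = ∅) :
    ∃ (j : A → ℕ) (g : A → B), Injective j ∧ (∀ a, 1 ≤ j a ∧ j a ≤ Fintype.card A) ∧
      (∀ a, g a ∈ N a ∧ e a ≠ g a) ∧
      ∀ b, #(unselected N e b) = 2 → ∀ a ∈ unselected N e b, ∀ a' ∈ unselected N e b, a ≠ a' →
        ((2 * j a - 1 + if g a = b then 0 else 2 * Fintype.card A) +
          (2 * j a' - 1 + if g a' = b then 0 else 2 * Fintype.card A)) % 4 =
        (2 * Fintype.card A) % 4 := by
  classical
  have htwo : ∀ a, ∃ x y, x ≠ y ∧ (N a).erase (e a) = {x, y} := fun a =>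
    Finset.card_eq_two.1 (by rw [Finset.card_erase_of_mem (he a), hN])
  rcases Nat.even_or_odd (Fintype.card A) with hn | hn
  · let R : A → A → Prop := fun a a' =>
      a ≠ a' ∧ ∃ b, #(unselected N e b) = 2 ∧ a ∈ unselected N e b ∧ a' ∈ unselected N e b
    have hpartner : ∀ a d, ∃ u, ∀ x, x ≠ a → #(unselected N e d) = 2 → a ∈ unselected N e d →
        x ∈ unselected N e d → x = u := by
      intro a d
      by_cases hex : ∃ u, u ≠ a ∧ u ∈ unselected N e d
      · obtain ⟨u, hua, hu⟩ := hex
        refine ⟨u, fun x hxa h2 ha hx => ?_⟩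
        have h1 : #((unselected N e d).erase a) = 1 := by
          rw [Finset.card_erase_of_mem ha, h2]
        exact Finset.card_le_one.1 h1.le x (Finset.mem_erase.2 ⟨hxa, hx⟩) u
          (Finset.mem_erase.2 ⟨hua, hu⟩)
      · exact ⟨a, fun x hxa _ _ hx => absurd ⟨x, hxa, hx⟩ hex⟩
    have hbranch : ∀ a x y, (N a).erase (e a) = {x, y} → ∀ d, a ∈ unselected N e d →
        d = x ∨ d = y := by
      intro a x y hxy d hd
      have hd' := mem_unselected.1 hd
      have : d ∈ (N a).erase (e a) := Finset.mem_erase.2 ⟨hd'.2.symm, hd'.1⟩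
      simpa [hxy] using this
    obtain ⟨s, hs, hbal⟩ := exists_balanced_coloring_s14 R (fun a h => h.1 rfl)
      (fun a a' ⟨h, b, h1, h2, h3⟩ => ⟨h.symm, b, h1, h3, h2⟩)
      (fun a => by
        obtain ⟨x, y, -, hxy⟩ := htwo a
        obtain ⟨u, hu⟩ := hpartner a x
        obtain ⟨v, hv⟩ := hpartner a y
        refine ⟨u, v, ?_⟩
        rintro z ⟨hz, d, h1, h2, h3⟩
        rcases hbranch a x y hxy d h2 with rfl | rfl
        · exact Or.inl (hu z hz.symm h1 h2 h3)
        · exact Or.inr (hv z hz.symm h1 h2 h3))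
      (fun S hS => by
        have hnc : ¬ IsCycleUnion N e S := fun h => hS.ne_empty (hcyc S h)
        unfold IsCycleUnion at hnc
        push Not at hnc
        obtain ⟨a, haS, b, hb, hab, hfree⟩ := hnc
        obtain ⟨d, hd⟩ : ∃ d, (N a).erase (e a) = {b, d} := by
          obtain ⟨x, y, -, hxy⟩ := htwo a
          rcases hbranch a x y hxy b (mem_unselected.2 ⟨hb, hab⟩) with rfl | rfl
          · exact ⟨y, hxy⟩
          · exact ⟨x, by rw [hxy, Finset.pair_comm]⟩
        obtain ⟨u, hu⟩ := hpartner a d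
        obtain ⟨v, hv⟩ := hpartner a b
        refine ⟨a, haS, u, ?_⟩
        rintro z hzS ⟨hz, c, h1, h2, h3⟩
        rcases hbranch a b d hd c h2 with rfl | rfl
        · refine absurd (fun y hy => ?_) (hfree h1)
          by_cases hya : y = a
          · exact hya ▸ haS
          · rw [hv y hya h1 h2 hy, ← hv z hz.symm h1 h2 h3]
            exact hzS
        · exact hu z hz.symm h1 h2 h3)
      univ hn
    obtain ⟨j, hj, hj1, hjs⟩ := exists_numbering_of_balanced s hbal
    choose x y _ hx using htwo
    have hmem : ∀ a, x a ∈ (N a).erase (e a) := fun a => by simp [hx a]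
    refine ⟨j, x, hj, hj1, fun a => ⟨Finset.mem_of_mem_erase (hmem a),
      (Finset.ne_of_mem_erase (hmem a)).symm⟩, fun b hb2 a ha a' ha' haa' => ?_⟩
    have h1 := hjs a a' (hs a (mem_univ _) a' (mem_univ _) ⟨haa', b, hb2, ha, ha'⟩)
    have h2 := hj1 a
    have h3 := hj1 a'
    obtain ⟨k, hk⟩ := hn
    split_ifs <;> omega
  · let j : A → ℕ := fun a => Fintype.equivFin A a + 1
    obtain ⟨g, hg, hgU⟩ := exists_orientation hN he hcyc (fun a => decide (j a % 2 = 0)) univ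
    refine ⟨j, g, fun a a' h => ?_, fun a => ⟨by simp [j], (Fintype.equivFin A a).2⟩, hg,
      fun b hb2 a ha a' ha' haa' => ?_⟩
    · exact (Fintype.equivFin A).injective (Fin.ext (Nat.succ_injective h))
    have h1 := hgU b hb2 a ha a' ha' haa' (mem_univ _) (mem_univ _)
    simp only [decide_eq_decide] at h1
    have h2 : 1 ≤ j a := by simp [j]
    have h3 : 1 ≤ j a' := by simp [j]
    obtain ⟨k, hk⟩ := hn
    generalize j a = x at *
    generalize j a' = y at *
    rcases Nat.mod_two_eq_zero_or_one x with h6 | h6 <;>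
    rcases Nat.mod_two_eq_zero_or_one y with h7 | h7 <;>
    split_ifs with h4 h5 h5 <;> simp [h4, h5, h6, h7] at h1 <;> omega

/-- The sum of three labels, of which the ones selected by `E` are `2` modulo `4` and the others
are odd, differs from `r` modulo `4` under a condition on the two odd labels. -/
theorem sum_mod_four_ne {A : Type*} [DecidableEq A] {T : Finset A} (hT : #T = 3) {E : A → Prop}
    [DecidablePred E] {L : A → ℕ} {r : ℕ} (hr : r % 2 = 0) (hE : ∀ a ∈ T, E a → L a % 4 = 2)
    (hO : ∀ a ∈ T, ¬ E a → L a % 2 = 1) (hne : {a ∈ T | ¬ E a}.Nonempty)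
    (hpair : #{a ∈ T | ¬ E a} = 2 → ∀ a ∈ T, ∀ a' ∈ T, a ≠ a' → ¬ E a → ¬ E a' →
      (L a + L a') % 4 = r % 4) : (∑ a ∈ T, L a) % 4 ≠ r % 4 := by
  obtain ⟨x, y, z, hxy, hxz, hyz, rfl⟩ := Finset.card_eq_three.1 hT
  have hsum : ∑ a ∈ ({x, y, z} : Finset A), L a = L x + L y + L z := by
    rw [Finset.sum_insert (by simp [hxy, hxz]), Finset.sum_pair hyz, add_assoc]
  rw [hsum]
  simp only [Finset.mem_insert, Finset.mem_singleton, forall_eq_or_imp, forall_eq] at hE hO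
  obtain ⟨hEx, hEy, hEz⟩ := hE
  obtain ⟨hOx, hOy, hOz⟩ := hO
  by_cases hx : E x <;> by_cases hy : E y <;> by_cases hz : E z <;>
    simp [hx, hy, hz, Finset.filter_insert, Finset.filter_singleton]
      at hne hpair hEx hEy hEz hOx hOy hOz
  all_goals
    try simp [hxy, hxz, hyz] at hpair
    omega

theorem exists_rank {B : Type*} [Fintype B] (P : B → ℕ) :
    ∃ r : B → ℕ, Injective r ∧ (∀ b, 1 ≤ r b ∧ r b ≤ Fintype.card B) ∧
      ∀ b b', r b < r b' → P b ≤ P b' := by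
  let φ := Fintype.equivFin B
  let σ := Tuple.sort (P ∘ φ.symm)
  refine ⟨fun b => σ.symm (φ b) + 1, fun b b' h => ?_, fun b => ⟨by simp, (σ.symm (φ b)).2⟩,
    fun b b' h => ?_⟩
  · exact φ.injective (σ.symm.injective (Fin.ext (Nat.succ_injective h)))
  · have hle : σ.symm (φ b) ≤ σ.symm (φ b') := Fin.le_def.2 (by simp only at h; omega)
    simpa [σ] using Tuple.monotone_sort (P ∘ φ.symm) hle

theorem exists_labeling_of_regular_four {A B : Type*} [Fintype A] [Fintype B] [DecidableEq A]
    [DecidableEq B] (N : A → Finset B) (hA : ∀ a, #(N a) = 4) (hB : ∀ b, #{a | b ∈ N a} = 4) :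
    ∃ L : A → B → ℕ, (∀ a, ∀ b ∈ N a, 1 ≤ L a b ∧ L a b ≤ 4 * Fintype.card A) ∧
      (∀ a, ∀ b ∈ N a, ∀ a', ∀ b' ∈ N a', L a b = L a' b' → a = a' ∧ b = b') ∧
      (∀ a a', ∑ b ∈ N a, L a b = ∑ b ∈ N a', L a' b → a = a') ∧
      (∀ b b', ∑ a with b ∈ N a, L a b = ∑ a with b' ∈ N a, L a b' → b = b') ∧
      ∀ a b, ∑ b' ∈ N a, L a b' ≠ ∑ a' with b ∈ N a', L a' b := by
  obtain ⟨m, hm, hmN⟩ := exists_injective_of_regular (by norm_num) N hA hB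
  have hcard := card_eq_of_regular (by norm_num) N hA hB
  have hmbij : Bijective m := (Fintype.bijective_iff_injective_and_card m).2 ⟨hm, hcard⟩
  set n := Fintype.card A with hn
  let N₃ : A → Finset B := fun a => (N a).erase (m a)
  have hmem : ∀ {a b}, b ∈ N₃ a ↔ m a ≠ b ∧ b ∈ N a := by
    intro a b
    simp [N₃, eq_comm]
  have hA₃ : ∀ a, #(N₃ a) = 3 := fun a => by
    simp only [N₃, Finset.card_erase_of_mem (hmN a), hA]
  have herase : ∀ a, ({x | m a ∈ N₃ x} : Finset A) = ({x | m a ∈ N x} : Finset A).erase a := by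
    intro a
    ext x
    simp [hmem, hm.eq_iff]
  have hB₃ : ∀ b, #{a | b ∈ N₃ a} = 3 := by
    intro b
    obtain ⟨a, rfl⟩ := hmbij.2 b
    rw [herase, Finset.card_erase_of_mem (by simpa using hmN a), hB]
  obtain ⟨e, he, hne, hcyc⟩ := exists_acyclic_selection N₃ hA₃ hB₃
  obtain ⟨j, g, hj, hj1, hg, hpair⟩ := exists_numbering_orientation hA₃ he hcyc
  rw [← hn] at hj1 hpair
  let L₃ : A → B → ℕ := fun a b =>
    if e a = b then 4 * n + 2 - 4 * j a else 2 * j a - 1 + if g a = b then 0 else 2 * n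
  let P : B → ℕ := fun b => ∑ a with b ∈ N₃ a, L₃ a b
  obtain ⟨r, hr, hr1, hrP⟩ := exists_rank P
  rw [← hcard] at hr1
  let L : A → B → ℕ := fun a b => if m a = b then 4 * r b else L₃ a b
  have hL₃ : ∀ a b, e a = b → L₃ a b % 4 = 2 := by
    intro a b hab
    have := hj1 a
    simp only [L₃, hab, if_true]
    omega
  have hodd : ∀ a b, e a ≠ b → L₃ a b % 2 = 1 := by
    intro a b hab
    have := hj1 a
    simp only [L₃, hab, if_false]
    split_ifs <;> omega
  have hP : ∀ b, P b % 4 ≠ (2 * n) % 4 := by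
    intro b
    have hU : ({a ∈ ({a | b ∈ N₃ a} : Finset A) | ¬ e a = b} : Finset A) = unselected N₃ e b := by
      ext x
      simp [mem_unselected]
    refine sum_mod_four_ne (hB₃ b) (E := fun a => e a = b) (by omega) (fun a _ => hL₃ a b)
      (fun a _ => hodd a b) (hU ▸ hne b) fun h2 a ha a' ha' haa' hea hea' => ?_
    have := hpair b (hU ▸ h2) a (hU ▸ Finset.mem_filter.2 ⟨ha, hea⟩) a'
      (hU ▸ Finset.mem_filter.2 ⟨ha', hea'⟩) haa'
    simpa only [L₃, hea, hea', if_false] using this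
  have hsumA : ∀ a, ∑ b ∈ N a, L a b = 4 * r (m a) + 6 * n := by
    intro a
    obtain ⟨h, hh⟩ : ∃ h, ((N₃ a).erase (e a)).erase (g a) = {h} := by
      rw [← Finset.card_eq_one, Finset.card_erase_of_mem
        (Finset.mem_erase.2 ⟨(hg a).2.symm, (hg a).1⟩), Finset.card_erase_of_mem (he a), hA₃]
    have hhe : h ∈ ((N₃ a).erase (e a)).erase (g a) := by simp [hh]
    simp only [Finset.mem_erase] at hhe
    obtain ⟨h1, h2, h3⟩ := hhe
    have h4 := (hmem.1 (he a)).1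
    have h5 := (hmem.1 (hg a).1).1
    have h6 := (hmem.1 h3).1
    rw [← Finset.add_sum_erase _ _ (hmN a), ← Finset.add_sum_erase _ _ (he a),
      ← Finset.add_sum_erase _ _ (Finset.mem_erase.2 ⟨(hg a).2.symm, (hg a).1⟩), hh,
      Finset.sum_singleton]
    have := hj1 a
    simp only [L, L₃, h4, h5, h6, (hg a).2, h1.symm, h2.symm, if_true, if_false]
    omega
  have hsumB : ∀ b, ∑ a with b ∈ N a, L a b = 4 * r b + P b := by
    intro b
    obtain ⟨a, rfl⟩ := hmbij.2 b
    rw [← Finset.add_sum_erase _ _ (show a ∈ ({x | m a ∈ N x} : Finset A) by simpa using hmN a),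
      ← herase]
    congr 1
    · simp [L]
    · refine Finset.sum_congr rfl fun x hx => ?_
      simp only [Finset.mem_filter, hmem] at hx
      simp only [L, hx.2.1, if_false]
  refine ⟨L, fun a b _ => ?_, fun a b hab a' b' hab' h => ?_, fun a a' h => ?_, fun b b' h => ?_,
    fun a b h => ?_⟩
  · have h1 := hj1 a
    have h2 := hr1 b
    simp only [L, L₃]
    split_ifs <;> omega
  · have h1 := hj1 a
    have h2 := hj1 a'
    have hodd' := hodd a b
    have hodd'' := hodd a' b'
    have hL₃' := hL₃ a b
    have hL₃'' := hL₃ a' b'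
    simp only [L] at h
    by_cases hmb : m a = b <;> by_cases hmb' : m a' = b' <;>
      simp only [hmb, hmb', if_true, if_false] at h
    · have hbb : b = b' := hr (by omega)
      exact ⟨hm (by rw [hmb, hmb', hbb]), hbb⟩
    · exfalso
      by_cases heb' : e a' = b' <;> grind
    · exfalso
      by_cases heb : e a = b <;> grind
    · by_cases heb : e a = b <;> by_cases heb' : e a' = b'
      · simp only [L₃, heb, heb', if_true] at h
        have haa : a = a' := hj (by omega)
        exact ⟨haa, by rw [← heb, ← heb', haa]⟩
      · grind
      · grind
      · simp only [L₃, heb, heb', if_false] at h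
        have haa : a = a' := hj (by split_ifs at h <;> omega)
        subst haa
        refine ⟨rfl, ?_⟩
        by_cases hgb : g a = b <;> by_cases hgb' : g a = b'
        · exact hgb.symm.trans hgb'
        · rw [if_pos hgb, if_neg hgb'] at h
          omega
        · rw [if_neg hgb, if_pos hgb'] at h
          omega
        · have hc : #(((N₃ a).erase (e a)).erase (g a)) ≤ 1 := by
            rw [Finset.card_erase_of_mem (Finset.mem_erase.2 ⟨(hg a).2.symm, (hg a).1⟩),
              Finset.card_erase_of_mem (he a), hA₃]
          refine Finset.card_le_one.1 hc b ?_ b' ?_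
          · simp only [Finset.mem_erase, hmem]
            exact ⟨Ne.symm hgb, Ne.symm heb, hmb, hab⟩
          · simp only [Finset.mem_erase, hmem]
            exact ⟨Ne.symm hgb', Ne.symm heb', hmb', hab'⟩
  · rw [hsumA, hsumA] at h
    exact hm (hr (by omega))
  · rw [hsumB, hsumB] at h
    refine hr (le_antisymm ?_ ?_) <;> by_contra hlt
    · have := hrP b' b (by omega)
      omega
    · have := hrP b b' (by omega)
      omega
  · rw [hsumA, hsumB] at h
    have := hP b
    omega

theorem stmt_14 {V : Type*} [Fintype V] [DecidableEq V] (G : SimpleGraph V)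
    [DecidableRel G.Adj] (c : V → Bool) (hbip : ∀ u v, G.Adj u v → c u ≠ c v)
    (hreg : G.IsRegularOfDegree 4) : IsAntimagic G := by
  let N : {v // c v = true} → Finset {v // c v = false} := fun a => {b | G.Adj a b}
  have hmem : ∀ {a b}, b ∈ N a ↔ G.Adj a b := by simp [N]
  have hNA : ∀ a : {v // c v = true}, (N a).map (Embedding.subtype _) = G.neighborFinset a := by
    intro a
    ext v
    simp only [Finset.mem_map, hmem, Embedding.subtype_apply, Subtype.exists,
      SimpleGraph.mem_neighborFinset]
    refine ⟨?_, fun h => ⟨v, ?_, h, rfl⟩⟩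
    · rintro ⟨w, hw, h, rfl⟩
      exact h
    · have := hbip _ _ h
      rw [a.2] at this
      simpa using this.symm
  have hNB : ∀ b : {v // c v = false}, ({a | b ∈ N a} : Finset _).map (Embedding.subtype _) =
      G.neighborFinset b := by
    intro b
    ext v
    simp only [Finset.mem_map, Finset.mem_filter, Finset.mem_univ, true_and, hmem,
      Embedding.subtype_apply, Subtype.exists, SimpleGraph.mem_neighborFinset]
    refine ⟨?_, fun h => ⟨v, ?_, h.symm, rfl⟩⟩
    · rintro ⟨w, hw, h, rfl⟩
      exact h.symm
    · have := hbip _ _ h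
      rw [b.2] at this
      simpa using this.symm
  have hA : ∀ a, #(N a) = 4 := fun a => by
    rw [← Finset.card_map, hNA, SimpleGraph.card_neighborFinset_eq_degree, hreg]
  have hB : ∀ b, #{a | b ∈ N a} = 4 := fun b => by
    rw [← Finset.card_map (Embedding.subtype _), hNB, SimpleGraph.card_neighborFinset_eq_degree,
      hreg]
  obtain ⟨L, hL1, hLinj, hsA, hsB, hsAB⟩ := exists_labeling_of_regular_four N hA hB
  let D : V → V → ℕ := fun u v =>
    if hu : c u = true then if hv : c v = false then L ⟨u, hu⟩ ⟨v, hv⟩ else 0 else 0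
  let f : Sym2 V → ℕ := Sym2.lift ⟨fun u v => D u v + D v u, fun u v => add_comm _ _⟩
  have hf : ∀ (a : {v // c v = true}) (b : {v // c v = false}), f s(↑a, ↑b) = L a b := by
    intro a b
    simp [f, D, a.2, b.2]
  have hedge : ∀ x ∈ G.edgeSet, ∃ (a : {v // c v = true}) (b : {v // c v = false}),
      b ∈ N a ∧ x = s(↑a, ↑b) := by
    intro x
    induction x using Sym2.ind with
    | _ u v =>
      intro h
      rw [SimpleGraph.mem_edgeSet] at h
      have huv := hbip u v h
      cases hu : c u with
      | true =>
        rw [hu] at huv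
        exact ⟨⟨u, hu⟩, ⟨v, by simpa using huv.symm⟩, hmem.2 h, rfl⟩
      | false =>
        rw [hu] at huv
        exact ⟨⟨v, by simpa using huv.symm⟩, ⟨u, hu⟩, hmem.2 h.symm, Sym2.eq_swap⟩
  have hsum : ∀ v, vertexSum G f v = ∑ w ∈ G.neighborFinset v, f s(v, w) := by
    intro v
    unfold vertexSum
    symm
    refine Finset.sum_bij (fun w _ => s(v, w)) ?_ ?_ ?_ ?_
    · intro w hw
      simpa [SimpleGraph.incidenceSet] using hw
    · intro w _ w' _ h
      exact Sym2.congr_right.1 h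
    · intro x hx
      rw [SimpleGraph.mem_incidenceFinset] at hx
      obtain ⟨w, rfl⟩ := Sym2.mem_iff_exists.1 hx.2
      exact ⟨w, by simpa using hx.1, rfl⟩
    · intros
      rfl
  have hsumA : ∀ a : {v // c v = true}, vertexSum G f a = ∑ b ∈ N a, L a b := by
    intro a
    rw [hsum, ← hNA, Finset.sum_map]
    exact Finset.sum_congr rfl fun b _ => hf a b
  have hsumB : ∀ b : {v // c v = false}, vertexSum G f b = ∑ a with b ∈ N a, L a b := by
    intro b
    rw [hsum, ← hNB, Finset.sum_map]
    refine Finset.sum_congr rfl fun a _ => ?_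
    rw [Embedding.subtype_apply, Sym2.eq_swap]
    exact hf a b
  have hEcard : #G.edgeFinset = 4 * Fintype.card {v // c v = true} := by
    have h1 := G.sum_degrees_eq_twice_card_edges
    have h2 := card_eq_of_regular (by norm_num) N hA hB
    have h3 : Fintype.card V =
        Fintype.card {v // c v = true} + Fintype.card {v // c v = false} := by
      have := Fintype.card_subtype_compl (fun v => c v = true)
      have h4 := Fintype.card_subtype_le (fun v => c v = true)
      simp only [Bool.not_eq_true] at this
      omega
    simp only [hreg.degree_eq, Finset.sum_const, Finset.card_univ, smul_eq_mul] at h1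
    omega
  have hmaps : Set.MapsTo f ↑G.edgeFinset ↑(Finset.Icc 1 #G.edgeFinset) := by
    intro x hx
    obtain ⟨a, b, hab, rfl⟩ := hedge x (by simpa using hx)
    rw [hf, hEcard, Finset.coe_Icc]
    exact hL1 a b hab
  have hinj : Set.InjOn f ↑G.edgeFinset := by
    intro x hx y hy hxy
    obtain ⟨a, b, hab, rfl⟩ := hedge x (by simpa using hx)
    obtain ⟨a', b', hab', rfl⟩ := hedge y (by simpa using hy)
    rw [hf, hf] at hxy
    obtain ⟨rfl, rfl⟩ := hLinj a b hab a' b' hab' hxy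
    rfl
  refine ⟨f, ⟨hmaps, hinj, Finset.surjOn_of_injOn_of_card_le f hmaps hinj (by simp)⟩, ?_⟩
  intro u v huv h
  cases hu : c u <;> cases hv : c v
  · exact huv (congrArg Subtype.val (hsB ⟨u, hu⟩ ⟨v, hv⟩ (by rw [← hsumB, ← hsumB]; exact h)))
  · exact hsAB ⟨v, hv⟩ ⟨u, hu⟩ (by rw [← hsumA, ← hsumB]; exact h.symm)
  · exact hsAB ⟨u, hu⟩ ⟨v, hv⟩ (by rw [← hsumA, ← hsumB]; exact h)
  · exact huv (congrArg Subtype.val (hsA ⟨u, hu⟩ ⟨v, hv⟩ (by rw [← hsumA, ← hsumA]; exact h)))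
end

section
/- Every 6-regular bipartite graph is antimagic. -/
open Finset

open Classical in
/-- A `(k + 1)`-regular bipartite relation contains a perfect matching. -/
theorem exists_equiv_of_regular_rel {A B : Type*} [Fintype A] [Fintype B] (k : ℕ)
    (R : A → B → Prop) (hA : ∀ a, #{b | R a b} = k + 1) (hB : ∀ b, #{a | R a b} = k + 1) :
    ∃ σ : A ≃ B, ∀ a, R a (σ a) := by
  have hcard : Fintype.card A = Fintype.card B := by
    have h := card_mul_eq_card_mul (s := (univ : Finset A)) (t := (univ : Finset B)) R
      (m := k + 1) (n := k + 1) (fun a _ => by simpa [bipartiteAbove] using hA a)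
      (fun b _ => by simpa [bipartiteBelow] using hB b)
    simpa using h
  obtain ⟨f, hf, hR⟩ := (Fintype.all_card_le_filter_rel_iff_exists_injective R).1 (by
    intro S
    have h := card_mul_le_card_mul (s := S) (t := {b | ∃ a ∈ S, R a b}) R
      (m := k + 1) (n := k + 1) (fun a ha => by
        rw [← hA a]
        apply card_le_card
        intro b hb
        simp only [mem_filter, mem_univ, true_and, bipartiteAbove] at hb ⊢
        exact ⟨⟨a, ha, hb⟩, hb⟩)
      (fun b _ => by
        rw [← hB b]
        apply card_le_card
        intro a ha
        simp only [mem_filter, mem_univ, true_and, bipartiteBelow] at ha ⊢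
        exact ha.2)
    exact Nat.le_of_mul_le_mul_right h k.succ_pos)
  exact ⟨Equiv.ofBijective f ((Fintype.bijective_iff_injective_and_card f).2 ⟨hf, hcard⟩), hR⟩

open Classical in
/-- A `k`-regular bipartite relation is the disjoint union of `k` perfect matchings. -/
theorem exists_factorization_of_regular_rel {A B : Type*} [Fintype A] [Fintype B] (k : ℕ)
    (R : A → B → Prop) (hA : ∀ a, #{b | R a b} = k) (hB : ∀ b, #{a | R a b} = k) :
    ∃ σ : Fin k → A ≃ B, (∀ a b, R a b ↔ ∃ i, σ i a = b) ∧
      ∀ a, Function.Injective fun i => σ i a := by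
  induction k generalizing R with
  | zero =>
    refine ⟨Fin.elim0, fun a b => ?_, fun a i => i.elim0⟩
    have h : b ∉ ({b | R a b} : Finset B) := by simp [card_eq_zero.1 (hA a)]
    simpa using h
  | succ k ih =>
    obtain ⟨τ, hτ⟩ := exists_equiv_of_regular_rel k R hA hB
    obtain ⟨σ, hσ, hinj⟩ := ih (fun a b => R a b ∧ τ a ≠ b) (fun a => by
        trans #(({b | R a b} : Finset B).erase (τ a))
        · congr 1
          ext b
          simp [and_comm, eq_comm]
        · rw [card_erase_of_mem (by simpa using hτ a), hA, Nat.add_sub_cancel])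
      (fun b => by
        trans #(({a | R a b} : Finset A).erase (τ.symm b))
        · congr 1
          ext a
          simp [and_comm, Equiv.eq_symm_apply]
        · rw [card_erase_of_mem (by simpa using hτ (τ.symm b)), hB, Nat.add_sub_cancel])
    refine ⟨Fin.cons τ σ, fun a b => ?_, fun a i j hij => ?_⟩
    · rw [Fin.exists_fin_succ]
      simp only [Fin.cons_zero, Fin.cons_succ, ← hσ]
      by_cases h : τ a = b
      · simpa [h] using h ▸ hτ a
      · simp [h]
    · have hne : ∀ i, τ a ≠ σ i a := fun i => ((hσ a (σ i a)).2 ⟨i, rfl⟩).2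
      induction i using Fin.cases with
      | zero =>
        induction j using Fin.cases with
        | zero => rfl
        | succ j => exact (hne j (by simpa using hij)).elim
      | succ i =>
        induction j using Fin.cases with
        | zero => exact (hne i (by simpa using hij.symm)).elim
        | succ j => exact congrArg Fin.succ (hinj a (by simpa using hij))

/-- The points of a fixed-point-free permutation can be coloured `0`, `1`, `2` so that along every
cycle the colours `0` and `1` alternate, except that a `2` may be inserted after a `0` and
before a `1`. -/
theorem exists_cycle_coloring {A : Type*} [Finite A] (π : Equiv.Perm A) (hπ : ∀ a, π a ≠ a) :
    ∃ col : A → Fin 3, ∀ a, (col a = 0 ∧ col (π a) = 1) ∨ (col a = 1 ∧ col (π a) = 0) ∨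
      (col a = 0 ∧ col (π a) = 2) ∨ (col a = 2 ∧ col (π a) = 1) := by
  classical
  obtain ⟨rep, hrep, hpow⟩ : ∃ rep : A → A, (∀ a, rep (π a) = rep a) ∧
      ∀ a, ∃ k : ℕ, (π ^ k) (rep a) = a := by
    let s := Equiv.Perm.SameCycle.setoid π
    refine ⟨fun a => (Quotient.mk s a).out, fun a => ?_, fun a => ?_⟩
    · have h : Quotient.mk s (π a) = Quotient.mk s a :=
        Quotient.sound (Equiv.Perm.sameCycle_apply_left.2 (Equiv.Perm.SameCycle.refl π a))
      exact congrArg Quotient.out h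
    · have h : π.SameCycle (Quotient.mk s a).out a := Quotient.mk_out (s := s) a
      obtain ⟨k, -, hk⟩ := h.exists_pow_eq'
      exact ⟨k, hk⟩
  let d : A → ℕ := fun a => Nat.find (hpow a)
  have hd : ∀ a, (π ^ d a) (rep a) = a := fun a => Nat.find_spec (hpow a)
  have hd_le : ∀ a k, (π ^ k) (rep a) = a → d a ≤ k := fun a k h => Nat.find_min' (hpow a) h
  have hzero : ∀ a, d a = 0 → rep a = a := fun a h => by simpa [h] using hd a
  have hstep : ∀ a, d (π a) = 0 ∨ d (π a) = d a + 1 := by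
    intro a
    have h1 : d (π a) ≤ d a + 1 := hd_le _ _ (by rw [hrep, pow_succ', Equiv.Perm.mul_apply, hd])
    rcases Nat.eq_zero_or_eq_succ_pred (d (π a)) with h | h
    · exact Or.inl h
    · right
      have h2 := hd (π a)
      rw [hrep, h, Nat.succ_eq_add_one, pow_succ', Equiv.Perm.mul_apply] at h2
      have h3 := hd_le a _ (π.injective h2)
      omega
  refine ⟨fun a => if d a = 0 ∧ Even (d (π.symm a)) then 2 else if Even (d a) then 0 else 1,
    fun a => ?_⟩
  have hne : ¬ (d a = 0 ∧ d (π a) = 0) := fun h => hπ a <| by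
    rw [← hzero _ h.2, hrep, hzero _ h.1]
  rcases hstep a with h | h
  · by_cases hp : Even (d a) <;> have h0 : d a ≠ 0 := fun h0 => hne ⟨h0, h⟩
    · simp [h, hp, h0]
    · simp [h, hp, h0]
  · by_cases h0 : d a = 0 ∧ Even (d (π.symm a))
    · simp [h0, h]
    · by_cases hp : Even (d a) <;> simp [h0, h, hp, Nat.even_add_one]

/-- The elements of a finite set can be numbered from `0`. -/
theorem exists_index {A : Type*} (S : Finset A) :
    ∃ r : A → ℕ, Set.InjOn r S ∧ ∀ a ∈ S, r a < #S := by
  classical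
  refine ⟨fun a => if h : a ∈ S then S.equivFin ⟨a, h⟩ else 0, fun a ha b hb h => ?_,
    fun a ha => ?_⟩
  · have ha' : a ∈ S := ha
    have hb' : b ∈ S := hb
    simp only [ha', hb', dite_true] at h
    simpa using S.equivFin.injective (Fin.ext h)
  · simp [ha]

/-- Distinct values from a finite set `L` can be assigned compatibly with a given weak order. -/
theorem exists_sorted_assignment {A : Type*} [Fintype A] (q : A → ℕ) (L : Finset ℕ)
    (hL : #L = Fintype.card A) :
    ∃ h : A → ℕ, Function.Injective h ∧ (∀ a, h a ∈ L) ∧ ∀ a b, q a < q b → h a < h b := by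
  let e := Fintype.equivFin A
  let s := Tuple.sort (q ∘ e.symm)
  refine ⟨fun a => L.orderEmbOfFin hL (s.symm (e a)), fun a b hab => by simpa using hab,
    fun a => orderEmbOfFin_mem _ _ _, fun a b hab => ?_⟩
  have hm := Tuple.monotone_sort (q ∘ e.symm)
  simp only [OrderEmbedding.lt_iff_lt]
  by_contra! hle
  have := hm hle
  simp [s] at this
  omega

/-- With `n` the number of points of a fixed-point-free permutation `π`, one member of each of `n`
pairs `{y, 6 n + 1 - y}` can be placed on the points so that the values at `a` and `π a` are always
far apart. -/
theorem exists_spread_labels {A : Type*} [Fintype A] (π : Equiv.Perm A) (hπ : ∀ a, π a ≠ a)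
    {n : ℕ} (hn : Fintype.card A = n) :
    ∃ (z : ℕ) (x : A → ℕ), 3 * z ≤ n ∧ Function.Injective x ∧ (∀ a b, x a + x b ≠ 6 * n + 1) ∧
      (∀ a, (1 ≤ x a ∧ x a + z ≤ n) ∨ (3 * n < x a + z ∧ x a ≤ 3 * n + z) ∨
        (5 * n + z < x a ∧ x a ≤ 6 * n)) ∧
      ∀ a, x a + 3 * n ≤ x (π a) + z ∨ x (π a) + 3 * n ≤ x a + z := by
  classical
  obtain ⟨col, hcol⟩ := exists_cycle_coloring π hπ
  have hcol' : ∀ a, _ := fun a => by simpa using hcol (π.symm a)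
  let M : Finset A := {a | col a = 2}
  let R : Finset A := {a | col a ≠ 2 ∧ col (π a) ≠ 2 ∧ col (π.symm a) ≠ 2}
  obtain ⟨j, hj, hjlt⟩ := exists_index M
  obtain ⟨r, hr, hrlt⟩ := exists_index R
  have hcard : #R + 3 * #M = n := by
    have h1 : #(M.map π.toEmbedding) = #M := card_map _
    have h2 : #(M.map π.symm.toEmbedding) = #M := card_map _
    have d1 : Disjoint M (M.map π.toEmbedding) := by
      rw [Finset.disjoint_left]
      intro a ha hb
      simp only [M, mem_map_equiv, mem_filter, mem_univ, true_and] at ha hb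
      have := hcol' a
      simp_all
    have d2 : Disjoint (M ∪ M.map π.toEmbedding) (M.map π.symm.toEmbedding) := by
      rw [Finset.disjoint_left]
      intro a ha hb
      simp only [M, mem_union, mem_map_equiv, mem_filter, mem_univ, true_and,
        Equiv.symm_symm] at ha hb
      have := hcol' a
      have := hcol a
      grind
    have hR : R = (M ∪ M.map π.toEmbedding ∪ M.map π.symm.toEmbedding)ᶜ := by
      ext a
      simp only [M, R, mem_compl, mem_union, mem_map_equiv, mem_filter, mem_univ, true_and,
        Equiv.symm_symm]
      tauto
    have := card_compl_add_card (M ∪ M.map π.toEmbedding ∪ M.map π.symm.toEmbedding)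
    rw [← hR, card_union_of_disjoint d2, card_union_of_disjoint d1, h1, h2, hn] at this
    omega
  set z := #M with hz
  have hjz : ∀ a, col a = 2 → j a < z := fun a ha => hjlt a (by simp [M, ha])
  have hrz : ∀ a, col a ≠ 2 → col (π a) ≠ 2 → col (π.symm a) ≠ 2 → r a + 3 * z < n :=
    fun a h1 h2 h3 => by
      have := hrlt a (by simp [R, h1, h2, h3])
      omega
  have hji : ∀ a b, col a = 2 → col b = 2 → j a = j b → a = b := fun a b ha hb h =>
    hj (by simp [M, ha]) (by simp [M, hb]) h
  have hri : ∀ a b, (col a ≠ 2 ∧ col (π a) ≠ 2 ∧ col (π.symm a) ≠ 2) →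
      (col b ≠ 2 ∧ col (π b) ≠ 2 ∧ col (π.symm b) ≠ 2) → r a = r b → a = b := fun a b ha hb h =>
    hr (by simpa [R] using ha) (by simpa [R] using hb) h
  let p : A → ℕ := fun a => if col a = 2 then 3 * n - j a else if col (π a) = 2 then z - j (π a)
    else if col (π.symm a) = 2 then z + 1 + j (π.symm a) else 2 * z + 1 + r a
  have hp : ∀ a, (col a = 2 ∧ p a = 3 * n - j a ∧ j a < z) ∨
      (col a = 0 ∧ col (π a) = 2 ∧ p a = z - j (π a) ∧ j (π a) < z) ∨
      (col a = 1 ∧ col (π.symm a) = 2 ∧ p a = z + 1 + j (π.symm a) ∧ j (π.symm a) < z) ∨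
      ((col a ≠ 2 ∧ col (π a) ≠ 2 ∧ col (π.symm a) ≠ 2) ∧ p a = 2 * z + 1 + r a ∧
        r a + 3 * z < n) := by
    intro a
    have h0 := hcol a
    have h0' := hcol' a
    by_cases h1 : col a = 2
    · left; exact ⟨h1, by simp [p, h1], hjz _ h1⟩
    by_cases h2 : col (π a) = 2
    · right; left; exact ⟨by simp_all, h2, by simp [p, h1, h2], hjz _ h2⟩
    by_cases h3 : col (π.symm a) = 2
    · right; right; left; exact ⟨by simp_all, h3, by simp [p, h1, h2, h3], hjz _ h3⟩
    · right; right; right; exact ⟨⟨h1, h2, h3⟩, by simp [p, h1, h2, h3], hrz _ h1 h2 h3⟩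
  have hpinj : ∀ a b, p a = p b → a = b := by
    intro a b hab
    rcases hp a with ⟨a1, a2, a3⟩ | ⟨a1, a2, a3, a4⟩ | ⟨a1, a2, a3, a4⟩ | ⟨a1, a2, a3⟩ <;>
    rcases hp b with ⟨b1, b2, b3⟩ | ⟨b1, b2, b3, b4⟩ | ⟨b1, b2, b3, b4⟩ | ⟨b1, b2, b3⟩ <;>
    first
      | exact hji a b a1 b1 (by omega)
      | exact π.injective (hji _ _ a2 b2 (by omega))
      | exact π.symm.injective (hji _ _ a2 b2 (by omega))
      | exact hri a b a1 b1 (by omega)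
      | (exfalso; omega)
  have hpz : ∀ a, (col a = 2 ∧ 3 * n < p a + z ∧ p a ≤ 3 * n) ∨
      (col a ≠ 2 ∧ 1 ≤ p a ∧ p a + z ≤ n) := by
    intro a
    rcases hp a with ⟨a1, a2, a3⟩ | ⟨a1, a2, a3, a4⟩ | ⟨a1, a2, a3, a4⟩ | ⟨a1, a2, a3⟩
    · left; exact ⟨a1, by omega, by omega⟩
    · right; exact ⟨by simp [a1], by omega, by omega⟩
    · right; exact ⟨by simp [a1], by omega, by omega⟩
    · right; exact ⟨a1.1, by omega, by omega⟩
  let x : A → ℕ := fun a => if col a = 1 then 6 * n + 1 - p a else p a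
  have hx1 : ∀ a, col a = 1 → x a = 6 * n + 1 - p a := fun a h => by simp [x, h]
  have hx0 : ∀ a, col a ≠ 1 → x a = p a := fun a h => by simp [x, h]
  have hx : ∀ a, (x a = p a ∨ x a = 6 * n + 1 - p a) ∧ p a ≤ 3 * n := by
    intro a
    refine ⟨?_, by rcases hpz a with h | h <;> omega⟩
    by_cases h : col a = 1
    · exact Or.inr (hx1 a h)
    · exact Or.inl (hx0 a h)
  refine ⟨z, x, by omega, fun a b hab => hpinj a b ?_, fun a b hab => ?_, fun a => ?_,
    fun a => ?_⟩
  · have := hx a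
    have := hx b
    omega
  · have ha := hx a
    have hb := hx b
    obtain rfl : a = b := hpinj a b (by omega)
    omega
  · have := hx a
    rcases hpz a with h | h <;> omega
  · have hne : p a ≠ p (π a) := fun h => hπ a (hpinj _ _ h).symm
    have ha := hpz a
    have hb := hpz (π a)
    rcases hcol a with ⟨h1, h2⟩ | ⟨h1, h2⟩ | ⟨h1, h2⟩ | ⟨h1, h2⟩
    · rw [hx1 _ h2, hx0 _ (by simp [h1])]
      simp only [h1, h2] at ha hb
      simp at ha hb
      omega
    · rw [hx1 _ h1, hx0 _ (by simp [h2])]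
      simp only [h1, h2] at ha hb
      simp at ha hb
      omega
    · rw [hx0 _ (by simp [h1]), hx0 _ (by simp [h2])]
      have h3 : p a = z - j (π a) := by simp [p, h1, h2]
      have h4 : p (π a) = 3 * n - j (π a) := by simp [p, h2]
      omega
    · rw [hx0 _ (by simp [h1]), hx1 _ h2]
      have h3 : p a = 3 * n - j a := by simp [p, h1]
      have h4 : p (π a) = z + 1 + j a := by
        have := hcol (π a)
        have h5 : col (π (π a)) ≠ 2 := by grind
        simp [p, h2, h5, h1]
      have := hjz a h1
      omega

/-- A permutation `w` of `{0, …, n - 1}` for which the sums `i + w i` are distinct and cover a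
central run of `n - 1` consecutive integers. -/
theorem exists_balanced_perm (n κ : ℕ) (hκ : κ = (n - 1) / 2) :
    ∃ w : ℕ → ℕ, (∀ i < n, w i < n) ∧ (∀ i < n, ∀ j < n, w i = w j → i = j) ∧
      (∀ i < n, ∀ j < n, i + w i = j + w j → i = j) ∧ (∀ i < n, κ ≤ i + w i) ∧
      (∀ i < n, i + 1 ≠ n → i + w i < n + κ) ∧ (n % 2 = 1 → ∀ i < n, i + w i < n + κ) ∧
      ∀ v, κ ≤ v → v + 2 ≤ κ + n → ∃ i < n, i + w i = v := by
  let w : ℕ → ℕ := fun i => if i = 2 * κ + 1 then 2 * κ + 1 else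
    if i % 2 = 0 then κ - i / 2 else 2 * κ - i / 2
  have hw : ∀ i, (i = 2 * κ + 1 ∧ w i = 2 * κ + 1) ∨
      (i ≠ 2 * κ + 1 ∧ i % 2 = 0 ∧ w i = κ - i / 2) ∨
      (i ≠ 2 * κ + 1 ∧ i % 2 = 1 ∧ w i = 2 * κ - i / 2) := by
    intro i
    simp only [w]
    split_ifs <;> omega
  refine ⟨w, fun i hi => ?_, fun i hi j hj h => ?_, fun i hi j hj h => ?_, fun i hi => ?_,
    fun i hi hi' => ?_, fun h i hi => ?_, fun v hv hv' => ?_⟩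
  · have := hw i; omega
  · have := hw i; have := hw j; omega
  · have := hw i; have := hw j; omega
  · have := hw i; omega
  · have := hw i; omega
  · have := hw i; omega
  · by_cases h : v ≤ 2 * κ
    · refine ⟨2 * (v - κ), by omega, ?_⟩
      have := hw (2 * (v - κ)); omega
    · refine ⟨2 * (v - 2 * κ) - 1, by omega, ?_⟩
      have := hw (2 * (v - 2 * κ) - 1); omega

/-- Labels for a bipartite graph that is a union of six perfect matchings, with the vertices of
the second part identified with those of the first along the matching `0`. -/
theorem exists_matching_labels_s15 {A : Type*} [Fintype A] (ρ : Fin 6 → Equiv.Perm A)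
    (h0 : ∀ a, ρ 0 a = a) (h1 : ∀ a, ρ 1 a ≠ a) :
    ∃ g : Fin 6 → A → ℕ, Function.Injective (fun p : Fin 6 × A => g p.1 p.2) ∧
      (∀ i a, 1 ≤ g i a ∧ g i a ≤ 6 * Fintype.card A) ∧
      Function.Injective (fun a => ∑ i, g i a) ∧
      Function.Injective (fun a => ∑ i, g i (ρ i a)) ∧
      ∀ a b, ∑ i, g i a ≠ ∑ i, g i (ρ i b) := by
  classical
  rcases isEmpty_or_nonempty A with hA | hA
  · exact ⟨fun _ _ => 0, fun p => isEmptyElim p.2, fun _ => isEmptyElim,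
      fun a => isEmptyElim a, fun a => isEmptyElim a, fun a => isEmptyElim a⟩
  obtain ⟨n, hn⟩ : ∃ n, Fintype.card A = n := ⟨_, rfl⟩
  have hpos : 0 < n := hn ▸ Fintype.card_pos
  obtain ⟨z, x, hz, hxinj, hxadd, hxmem, hxgap⟩ := exists_spread_labels (ρ 1) h1 hn
  obtain ⟨l, hl⟩ := Finite.exists_min x
  obtain ⟨κ, hκ⟩ : ∃ κ, κ = (n - 1) / 2 := ⟨_, rfl⟩
  obtain ⟨w, hwlt, hwinj, huinj, hu_ge, hu_lt, hu_lt', hu_surj⟩ := exists_balanced_perm n κ hκ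
  obtain ⟨ι, hιlt, hιinj, hιsurj, hιl⟩ : ∃ ι : A → ℕ, (∀ a, ι a < n) ∧ Function.Injective ι ∧
      (∀ i < n, ∃ a, ι a = i) ∧ ι (ρ 4 l) + 1 = n := by
    let e := (Fintype.equivFinOfCardEq hn).trans
      (Equiv.swap (Fintype.equivFinOfCardEq hn (ρ 4 l)) ⟨n - 1, by omega⟩)
    refine ⟨fun a => e a, fun a => (e a).2, fun a b h => e.injective (Fin.ext h),
      fun i hi => ⟨e.symm ⟨i, hi⟩, by simp⟩, ?_⟩
    simp only [e, Equiv.trans_apply, Equiv.swap_apply_left]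
    omega
  let u : A → ℕ := fun a => 5 * n + z + κ - (ι a + w (ι a))
  have hu : ∀ a, u a + (ι a + w (ι a)) = 5 * n + z + κ := fun a => by
    have := hιlt a
    have := hwlt _ (hιlt a)
    simp only [u]
    omega
  have huinj' : Function.Injective u := fun a b h => by
    have ha := hu a
    have hb := hu b
    exact hιinj (huinj _ (hιlt a) _ (hιlt b) (by omega))
  have hurange : ∀ a, 3 * n + z < u a ∧ u a ≤ 5 * n + z := fun a => by
    have := hu a
    have := hu_ge _ (hιlt a)
    have := hιlt a
    have := hwlt _ (hιlt a)
    omega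
  let L : Finset ℕ := Icc (3 * n + z + 1) (5 * n + z) \ univ.image u
  have hL : #L = Fintype.card A := by
    have hsub : univ.image u ⊆ Icc (3 * n + z + 1) (5 * n + z) := by
      intro v hv
      obtain ⟨a, -, rfl⟩ := mem_image.1 hv
      exact mem_Icc.2 (hurange a)
    rw [card_sdiff_of_subset hsub, card_image_of_injective _ huinj', card_univ, Nat.card_Icc, hn]
    omega
  have hLrange : ∀ v ∈ L, (3 * n + z < v ∧ v ≤ 4 * n + z + 1) ∧ ∀ a, u a ≠ v := by
    intro v hv
    simp only [L, mem_sdiff, mem_Icc, mem_image, mem_univ, true_and, not_exists] at hv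
    refine ⟨⟨by omega, ?_⟩, hv.2⟩
    by_contra! hlt
    obtain ⟨i, hi, hiv⟩ := hu_surj (5 * n + z + κ - v) (by omega) (by omega)
    obtain ⟨a, rfl⟩ := hιsurj i hi
    exact hv.2 a (by have := hu a; omega)
  let q : A → ℕ := fun a => x a + (6 * n + 1 - x (ρ 1 a)) + (n - z + 1 + ι (ρ 2 a)) +
    (2 * n - z + 1 + w (ι (ρ 3 a))) + u (ρ 4 a)
  obtain ⟨h, hinj, hmem, hmono⟩ := exists_sorted_assignment q L hL
  let g : Fin 6 → A → ℕ := ![x, fun a => 6 * n + 1 - x a, fun a => n - z + 1 + ι a,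
    fun a => 2 * n - z + 1 + w (ι a), u, fun a => h ((ρ 5).symm a)]
  have hxle : ∀ a, 1 ≤ x a ∧ x a ≤ 6 * n := fun a => by
    have := hxmem a
    omega
  have hS : ∀ a, ∑ i, g i a + z = 14 * n + 3 + κ + h ((ρ 5).symm a) := by
    intro a
    have h2 : ∑ i, g i a = x a + (6 * n + 1 - x a) + (n - z + 1 + ι a) +
        (2 * n - z + 1 + w (ι a)) + u a + h ((ρ 5).symm a) := by
      simp [Fin.sum_univ_six, g]
    have := hu a
    have := hxle a
    omega
  have hT : ∀ a, ∑ i, g i (ρ i a) = q a + h a := by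
    intro a
    simp [Fin.sum_univ_six, g, q, h0]
  have hq : ∀ a, q a + z + n < 14 * n + 3 + κ ∨ 14 * n + 3 + κ + n < q a + z := by
    intro a
    have hxa := hxle a
    have hxb := hxle (ρ 1 a)
    have h2 := hιlt (ρ 2 a)
    have h3 := hwlt _ (hιlt (ρ 3 a))
    have h4 := hu (ρ 4 a)
    rcases hxgap a with hgap | hgap
    · left
      have := hu_ge _ (hιlt (ρ 4 a))
      simp only [q]
      omega
    · right
      have hne : ι (ρ 4 a) + 1 ≠ n := by
        intro hlast
        obtain rfl : a = l := (ρ 4).injective (hιinj (by omega))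
        have := hl (ρ 1 a)
        omega
      have := hu_lt _ (hιlt (ρ 4 a)) hne
      simp only [q]
      omega
  have hh : ∀ a, (3 * n + z < h a ∧ h a ≤ 4 * n + z + 1) ∧ ∀ b, u b ≠ h a :=
    fun a => hLrange _ (hmem a)
  refine ⟨g, ?_, fun i a => ?_, fun a b hab => ?_, fun a b hab => ?_, fun a b hab => ?_⟩
  · have hsame : ∀ i a b, g i a = g i b → a = b := by
      intro i a b hij
      have e0 := hxle a
      have e0' := hxle b
      have e2 := hιlt a
      have e2' := hιlt b
      fin_cases i <;> simp [g] at hij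
      · exact hxinj hij
      · exact hxinj (by omega)
      · exact hιinj hij
      · exact hιinj (hwinj _ e2 _ e2' hij)
      · exact huinj' hij
      · exact (ρ 5).symm.injective (hinj hij)
    have hdiff : ∀ i j a b, i < j → g i a ≠ g j b := by
      intro i j a b hij
      have e0 := hxmem a
      have e0' := hxmem b
      have e1 := hxadd a b
      have e2 := hιlt a
      have e2' := hιlt b
      have e3 := hwlt _ e2
      have e3' := hwlt _ e2'
      have e4 := hurange a
      have e4' := hurange b
      obtain ⟨e5, e6⟩ := hh ((ρ 5).symm b)
      have e6 := e6 a
      clear hxmem hxadd hιlt hwlt hurange hh hS hT hq hLrange hu hmono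
      fin_cases i <;> fin_cases j <;> simp [g] at hij ⊢ <;> omega
    rintro ⟨i, a⟩ ⟨j, b⟩ hij
    rcases lt_trichotomy i j with hlt | rfl | hlt
    · exact (hdiff i j a b hlt hij).elim
    · exact congrArg (Prod.mk i) (hsame i a b hij)
    · exact (hdiff j i b a hlt hij.symm).elim
  · have e0 := hxle a
    have e2 := hιlt a
    have e3 := hwlt _ e2
    have e4 := hurange a
    have e5 := (hh ((ρ 5).symm a)).1
    rw [hn]
    fin_cases i <;> simp [g] <;> omega
  · have ha := hS a
    have hb := hS b
    exact (ρ 5).symm.injective (hinj (by simp only at hab; omega))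
  · simp only [hT] at hab
    rcases lt_trichotomy (q a) (q b) with hlt | heq | hlt
    · have := hmono a b hlt
      omega
    · exact hinj (by omega)
    · have := hmono b a hlt
      omega
  · have ha := hS a
    rw [hab, hT] at ha
    have := (hh ((ρ 5).symm a)).1
    have := (hh b).1
    have := hq b
    omega

/-- A bipartite graph whose edges are partitioned into six perfect matchings is antimagic. -/
theorem isAntimagic_of_matchings {V : Type*} [Fintype V] [DecidableEq V] (G : SimpleGraph V)
    [DecidableRel G.Adj] (c : V → Bool) (hbip : ∀ u v, G.Adj u v → c u ≠ c v)
    (σ : Fin 6 → {v // c v = true} ≃ {v // c v = false})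
    (hσ : ∀ a b, G.Adj a.1 b.1 ↔ ∃ i, σ i a = b)
    (hinj : ∀ a, Function.Injective fun i => σ i a) : IsAntimagic G := by
  obtain ⟨g, hg, hgmem, hS, hT, hST⟩ :=
    exists_matching_labels_s15 (fun i => (σ 0).trans (σ i).symm) (fun a => by simp) (fun a h => by
      rw [Equiv.trans_apply, Equiv.symm_apply_eq] at h
      exact absurd (hinj a h) (by decide))
  let E : Fin 6 × {v // c v = true} → Sym2 V := fun p => s(p.2.1, (σ p.1 p.2).1)
  have hne : ∀ (a : {v // c v = true}) (b : {v // c v = false}), a.1 ≠ b.1 := fun a b h => by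
    have := a.2
    rw [h, b.2] at this
    simp at this
  have hEinj : Function.Injective E := by
    rintro ⟨i, a⟩ ⟨j, b⟩ h
    rcases Sym2.eq_iff.1 h with ⟨h1, h2⟩ | ⟨h1, -⟩
    · obtain rfl : a = b := Subtype.ext h1
      exact congrArg (fun i => (i, a)) (hinj a (Subtype.ext h2))
    · exact (hne _ _ h1).elim
  have hE : ∀ e, e ∈ G.edgeSet ↔ ∃ p, E p = e := by
    intro e
    constructor
    · induction e using Sym2.ind with
      | _ u v =>
        intro h
        rw [SimpleGraph.mem_edgeSet] at h
        have hc := hbip u v h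
        cases hu : c u
        · have hv : c v = true := by simpa [hu] using hc.symm
          obtain ⟨i, hi⟩ := (hσ ⟨v, hv⟩ ⟨u, hu⟩).1 h.symm
          exact ⟨(i, ⟨v, hv⟩), by simp [E, hi, Sym2.eq_swap]⟩
        · have hv : c v = false := by simpa [hu] using hc.symm
          obtain ⟨i, hi⟩ := (hσ ⟨u, hu⟩ ⟨v, hv⟩).1 h
          exact ⟨(i, ⟨u, hu⟩), by simp [E, hi]⟩
    · rintro ⟨⟨i, a⟩, rfl⟩
      exact (hσ _ _).2 ⟨i, rfl⟩
  have hEset : G.edgeFinset = univ.image E := by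
    ext e
    simp only [SimpleGraph.mem_edgeFinset, hE, mem_image, mem_univ, true_and]
  have hcard : #G.edgeFinset = 6 * Fintype.card {v // c v = true} := by
    rw [hEset, card_image_of_injective _ hEinj, card_univ, Fintype.card_prod, Fintype.card_fin]
  let f : Sym2 V → ℕ := Function.extend E (fun p => g p.1 p.2) 0
  have hf : ∀ i a, f (E (i, a)) = g i a := fun i a => hEinj.extend_apply _ _ (i, a)
  have hsumA : ∀ a : {v // c v = true}, vertexSum G f a.1 = ∑ i, g i a := by
    intro a
    have h : G.incidenceFinset a.1 = univ.image fun i => E (i, a) := by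
      ext e
      rw [SimpleGraph.mem_incidenceFinset, SimpleGraph.incidenceSet, Set.mem_sep_iff, hE]
      simp only [mem_image, mem_univ, true_and]
      constructor
      · rintro ⟨⟨⟨i, b⟩, rfl⟩, h⟩
        rcases Sym2.mem_iff.1 h with h | h
        · obtain rfl : a = b := Subtype.ext h
          exact ⟨i, rfl⟩
        · exact (hne _ _ h).elim
      · rintro ⟨i, rfl⟩
        exact ⟨⟨_, rfl⟩, Sym2.mem_mk_left _ _⟩
    rw [vertexSum, h, sum_image fun i _ j _ hij => congrArg Prod.fst (hEinj hij)]
    simp only [hf]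
  have hsumB : ∀ b : {v // c v = false}, vertexSum G f b.1 = ∑ i, g i ((σ i).symm b) := by
    intro b
    have h : G.incidenceFinset b.1 = univ.image fun i => E (i, (σ i).symm b) := by
      ext e
      rw [SimpleGraph.mem_incidenceFinset, SimpleGraph.incidenceSet, Set.mem_sep_iff, hE]
      simp only [mem_image, mem_univ, true_and]
      constructor
      · rintro ⟨⟨⟨i, a⟩, rfl⟩, h⟩
        rcases Sym2.mem_iff.1 h with h | h
        · exact (hne _ _ h.symm).elim
        · obtain rfl : b = σ i a := Subtype.ext h
          exact ⟨i, by simp⟩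
      · rintro ⟨i, rfl⟩
        exact ⟨⟨_, rfl⟩, by simp [E]⟩
    rw [vertexSum, h, sum_image fun i _ j _ hij => congrArg Prod.fst (hEinj hij)]
    simp only [hf]
  have hsumB' : ∀ b : {v // c v = false}, ∃ a, σ 0 a = b ∧
      vertexSum G f b.1 = ∑ i, g i (((σ 0).trans (σ i).symm) a) := fun b =>
    ⟨(σ 0).symm b, by simp, by simp [hsumB]⟩
  refine ⟨f, ?_, fun u v huv h => ?_⟩
  · have hmaps : Set.MapsTo f G.edgeFinset (Icc 1 #G.edgeFinset) := by
      intro e he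
      obtain ⟨⟨i, a⟩, rfl⟩ := (hE e).1 (SimpleGraph.mem_edgeFinset.1 he)
      rw [hf, mem_coe, mem_Icc, hcard]
      exact hgmem i a
    have hinjOn : Set.InjOn f G.edgeFinset := by
      intro e he e' he' hee
      obtain ⟨⟨i, a⟩, rfl⟩ := (hE e).1 (SimpleGraph.mem_edgeFinset.1 he)
      obtain ⟨⟨j, b⟩, rfl⟩ := (hE e').1 (SimpleGraph.mem_edgeFinset.1 he')
      rw [hf, hf] at hee
      exact congrArg E (hg hee)
    exact ⟨hmaps, hinjOn, surjOn_of_injOn_of_card_le f hmaps hinjOn (by simp)⟩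
  · cases hu : c u <;> cases hv : c v
    · obtain ⟨a, ha, hsa⟩ := hsumB' ⟨u, hu⟩
      obtain ⟨b, hb, hsb⟩ := hsumB' ⟨v, hv⟩
      obtain rfl : a = b := hT (hsa.symm.trans (h.trans hsb))
      exact huv (congrArg Subtype.val (ha.symm.trans hb))
    · obtain ⟨a, -, hsa⟩ := hsumB' ⟨u, hu⟩
      exact hST _ _ ((hsumA ⟨v, hv⟩).symm.trans (h.symm.trans hsa))
    · obtain ⟨b, -, hsb⟩ := hsumB' ⟨v, hv⟩
      exact hST _ _ ((hsumA ⟨u, hu⟩).symm.trans (h.trans hsb))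
    · exact huv (congrArg Subtype.val
        (hS ((hsumA ⟨u, hu⟩).symm.trans (h.trans (hsumA ⟨v, hv⟩)))))

theorem stmt_15 {V : Type*} [Fintype V] [DecidableEq V] (G : SimpleGraph V)
    [DecidableRel G.Adj] (c : V → Bool) (hbip : ∀ u v, G.Adj u v → c u ≠ c v)
    (hreg : G.IsRegularOfDegree 6) : IsAntimagic G := by
  classical
  have hdeg : ∀ (x : Bool) (v : V), c v ≠ x → #{w : {w // c w = x} | G.Adj v w.1} = 6 := by
    intro x v hv
    rw [← hreg v, ← SimpleGraph.card_neighborFinset_eq_degree,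
      ← card_map (Function.Embedding.subtype _)]
    congr 1
    ext w
    simp only [mem_map, mem_filter, mem_univ, true_and, Function.Embedding.coe_subtype,
      Subtype.exists, SimpleGraph.mem_neighborFinset]
    constructor
    · rintro ⟨w, hw, h, rfl⟩
      exact h
    · intro h
      have := hbip v w h
      exact ⟨w, by revert hv this; cases c v <;> cases c w <;> cases x <;> simp, h, rfl⟩
  obtain ⟨σ, hσ, hinj⟩ := exists_factorization_of_regular_rel 6
    (fun (a : {v // c v = true}) (b : {v // c v = false}) => G.Adj a.1 b.1)
    (fun a => by convert! hdeg false a.1 (by simp [a.2]))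
    (fun b => by
      simp only [G.adj_comm _ b.1]
      convert! hdeg true b.1 (by simp [b.2]))
  exact isAntimagic_of_matchings G c hbip σ hσ hinj
end
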